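/- For every constant ε > 0 there exist constants δ > 0, λ > 0 and n_0 such that the following holds for all n ≥ n_0. Let M be a k-pass streaming algorithm with k < n^λ on a stream X_1,…,X_n of i.i.d. uniform {-1,1} bits. If MIC_cond(M) ≤ δ·n·log₂ n and H(M_i) ≤ n^λ for every i ∈ {0,1,…,k}, then E over M_{(k,n)} of (E[Σ_{j=1}^n X_j | M_{(k,n)}])² is at most ε·n. -/

import Mathlib

open scoped Classical
open Finset

noncomputable section

namespace MultiPassIC

/-- Probability of an event under a probability mass function `p` on a finite sample space. -/
def pr {Ω : Type} [Fintype Ω] (p : Ω → ℝ) (E : Ω → Prop) : ℝ :=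
  ∑ ω, if E ω then p ω else 0

/-- `p` is a probability mass function on the finite type `Ω`. -/
structure IsPMF {Ω : Type} [Fintype Ω] (p : Ω → ℝ) : Prop where
  nonneg : ∀ ω, 0 ≤ p ω
  sum_one : ∑ ω, p ω = 1

/-- Shannon entropy (base 2) of the random variable `A` under `p`. -/
def H {Ω : Type} [Fintype Ω] {α : Type} [Fintype α] (p : Ω → ℝ) (A : Ω → α) : ℝ :=
  -∑ a, pr p (fun ω => A ω = a) * Real.logb 2 (pr p (fun ω => A ω = a))

/-- Conditional mutual information `I(A ; B ∣ C)` (base 2), with the usual conventions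
for vanishing probabilities. -/
def condMI {Ω : Type} [Fintype Ω] {α β γ : Type} [Fintype α] [Fintype β] [Fintype γ]
    (p : Ω → ℝ) (A : Ω → α) (B : Ω → β) (C : Ω → γ) : ℝ :=
  ∑ a, ∑ b, ∑ c,
    pr p (fun ω => A ω = a ∧ B ω = b ∧ C ω = c) *
      Real.logb 2 ((pr p (fun ω => C ω = c) *
          pr p (fun ω => A ω = a ∧ B ω = b ∧ C ω = c)) /
        (pr p (fun ω => A ω = a ∧ C ω = c) * pr p (fun ω => B ω = b ∧ C ω = c)))

/-- Mutual information `I(A ; B)` (base 2). -/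
def MI {Ω : Type} [Fintype Ω] {α β : Type} [Fintype α] [Fintype β]
    (p : Ω → ℝ) (A : Ω → α) (B : Ω → β) : ℝ :=
  condMI p A B (fun _ => (0 : Fin 1))

/-- `X 0, …, X (n-1)` (the first `n` stream elements) are mutually independent under `p`,
i.e. they are drawn from a product distribution. -/
def IsProduct {Ω : Type} [Fintype Ω] {𝒳 : Type} (p : Ω → ℝ) (n : ℕ) (X : ℕ → Ω → 𝒳) : Prop :=
  ∀ x : ℕ → 𝒳,
    pr p (fun ω => ∀ j < n, X j ω = x j) =
      ∏ j ∈ Finset.range n, pr p (fun ω => X j ω = x j)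

/-- A `k`-pass streaming algorithm on the input stream `X 0, …, X (n-1)` (0-indexed;
the paper's `X_j` is `X (j-1)`), over a finite sample space `Ω` with pmf `p`.
`S` is the finite set of memory states, `Rv` the value space of the per-step private
randomness, `init` the initial memory state `M₀`, `R i j` the private randomness used at
step `j` of pass `i` (0-indexed), and `f i j` the corresponding transition function.
The field `indep` states that the initial state, all the per-step random seeds, and the
input stream are mutually independent. -/
structure Alg (Ω : Type) [Fintype Ω] (p : Ω → ℝ) (𝒳 : Type) [Fintype 𝒳]
    (n k : ℕ) (X : ℕ → Ω → 𝒳) where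
  S : Type
  fintS : Fintype S
  Rv : Type
  fintR : Fintype Rv
  init : Ω → S
  R : ℕ → ℕ → Ω → Rv
  f : ℕ → ℕ → 𝒳 → S → Rv → S
  indep : ∀ (m : S) (r : ℕ → ℕ → Rv) (x : ℕ → 𝒳),
    pr p (fun ω => init ω = m ∧ (∀ i < k, ∀ j < n, R i j ω = r i j) ∧ (∀ j < n, X j ω = x j))
      = pr p (fun ω => init ω = m)
        * (∏ i ∈ Finset.range k, ∏ j ∈ Finset.range n, pr p (fun ω => R i j ω = r i j))
        * pr p (fun ω => ∀ j < n, X j ω = x j)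

attribute [instance] Alg.fintS Alg.fintR

variable {Ω : Type} [Fintype Ω] {p : Ω → ℝ} {𝒳 : Type} [Fintype 𝒳] {n k : ℕ} {X : ℕ → Ω → 𝒳}

/-- Running pass `i` (0-indexed) of the algorithm for `j` steps starting from `ini`. -/
def Alg.runPass (M : Alg Ω p 𝒳 n k X) (i : ℕ) (ini : Ω → M.S) : ℕ → Ω → M.S
  | 0 => ini
  | j + 1 => fun ω =>
      if j < n ∧ i < k then
        M.f i j (X j ω) (M.runPass i ini j ω) (M.R i j ω)
      else M.runPass i ini j ω

/-- `M.passEnd i` is the memory state at the end of pass `i`; `M.passEnd 0 = M₀` is the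
initial state, and `M.passEnd i` is the paper's `M_i = M_{(i,n)}`. -/
def Alg.passEnd (M : Alg Ω p 𝒳 n k X) : ℕ → Ω → M.S
  | 0 => M.init
  | i + 1 => M.runPass i (M.passEnd i) n

/-- `M.st i j` is the memory state after reading `j` elements in pass `i+1`;
it is the paper's `M_{(i+1, j)}`. -/
def Alg.st (M : Alg Ω p 𝒳 n k X) (i j : ℕ) : Ω → M.S :=
  M.runPass i (M.passEnd i) j

/-- The multi-pass information cost
`MIC(M, μ) = Σ_{i=1}^{k} Σ_{j=1}^{n} Σ_{ℓ=1}^{j} I(M_{(i,j)}; X_ℓ | M_{(≤i,ℓ-1)}, M_{(≤i-1,j)})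
  + Σ_{i=1}^{k} Σ_{j=1}^{n} Σ_{ℓ=j+1}^{n} I(M_{(i,j)}; X_ℓ | M_{(≤i-1,ℓ-1)}, M_{(≤i-1,j)})`
(all summation indices below are 0-indexed shifts of the paper's 1-indexed ones). -/
def Alg.MIC (M : Alg Ω p 𝒳 n k X) : ℝ :=
  (∑ i ∈ Finset.range k, ∑ j ∈ Finset.range n, ∑ l ∈ Finset.range (j + 1),
    condMI p (M.st i (j + 1)) (X l)
      (fun ω => ((fun r : Fin (i + 1) => M.st r.1 l ω),
                 (fun r : Fin i => M.st r.1 (j + 1) ω))))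
  + (∑ i ∈ Finset.range k, ∑ j ∈ Finset.range n, ∑ l ∈ Finset.Ico (j + 1) n,
    condMI p (M.st i (j + 1)) (X l)
      (fun ω => ((fun r : Fin i => M.st r.1 l ω),
                 (fun r : Fin i => M.st r.1 (j + 1) ω))))

/-- The conditional information cost
`MIC_cond(M, μ) = Σ_{j=1}^{n} Σ_{ℓ=1}^{j} I(M_{(≤k,j)}; X_ℓ | M_{<k}, M_{(≤k,ℓ-1)})`. -/
def Alg.MICcond (M : Alg Ω p 𝒳 n k X) : ℝ :=
  ∑ j ∈ Finset.range n, ∑ l ∈ Finset.range (j + 1),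
    condMI p (fun ω => fun r : Fin k => M.st r.1 (j + 1) ω) (X l)
      (fun ω => ((fun r : Fin k => M.passEnd r.1 ω),
                 (fun r : Fin k => M.st r.1 l ω)))

end MultiPassIC

namespace MultiPassIC

/-- `E_{m ∼ M} [ (E[Z | M = m])² ]`: the expected squared conditional expectation of the
real random variable `Z` given the random variable `M`. -/
def expSqCond {Ω : Type} [Fintype Ω] {σ : Type} [Fintype σ]
    (p : Ω → ℝ) (Z : Ω → ℝ) (M : Ω → σ) : ℝ :=
  ∑ m, pr p (fun ω => M ω = m) *
    ((∑ ω, if M ω = m then p ω * Z ω else 0) / pr p (fun ω => M ω = m)) ^ 2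

/-- The ±1 value of a boolean coin. -/
def coin (b : Bool) : ℝ := if b then 1 else -1

section Determined

variable {Ω : Type}

/-- `B` is a function of `A`: it is constant on the fibres of `A`. -/
def Det {α β : Type} (A : Ω → α) (B : Ω → β) : Prop :=
  ∀ ω ω', A ω = A ω' → B ω = B ω'

lemma Det.mul {α : Type} {A : Ω → α} {f g : Ω → ℝ} (hf : Det A f) (hg : Det A g) :
    Det A (fun ω => f ω * g ω) :=
  fun ω ω' h => by simp only [hf ω ω' h, hg ω ω' h]

lemma Det.prodMk {α β γ : Type} {A : Ω → α} {f : Ω → β} {g : Ω → γ} (hf : Det A f)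
    (hg : Det A g) : Det A (fun ω => (f ω, g ω)) :=
  fun ω ω' h => by simp only [hf ω ω' h, hg ω ω' h]

lemma Det.trans {α β γ : Type} {A : Ω → α} {B : Ω → β} {C : Ω → γ} (h : Det A B)
    (h' : Det B C) : Det A C :=
  fun ω ω' hA => h' ω ω' (h ω ω' hA)

end Determined

section FiniteProbability

variable {Ω : Type} [Fintype Ω] {p : Ω → ℝ}

/-- Expectation under `p`. -/
def ex (p : Ω → ℝ) (Z : Ω → ℝ) : ℝ := ∑ ω, p ω * Z ω

/-- Conditional expectation of `Z` given `A`. -/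
def ce {α : Type} (p : Ω → ℝ) (A : Ω → α) (Z : Ω → ℝ) (ω : Ω) : ℝ :=
  (∑ ω', if A ω' = A ω then p ω' * Z ω' else 0) / pr p (A · = A ω)

/-- The second moment of the conditional expectation of `Z` given `A`. -/
def sqCond {α : Type} (p : Ω → ℝ) (A : Ω → α) (Z : Ω → ℝ) : ℝ :=
  ex p (fun ω => ce p A Z ω ^ 2)

lemma pr_nonneg (hp : IsPMF p) (E : Ω → Prop) : 0 ≤ pr p E :=
  Finset.sum_nonneg fun ω _ => by split_ifs <;> simp [hp.nonneg ω]

lemma pr_mono (hp : IsPMF p) {E F : Ω → Prop} (h : ∀ ω, E ω → F ω) : pr p E ≤ pr p F := by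
  refine Finset.sum_le_sum fun ω _ => ?_
  by_cases hE : E ω
  · simp [hE, h ω hE]
  · simp only [hE, if_false]
    split_ifs <;> simp [hp.nonneg ω]

lemma le_pr (hp : IsPMF p) {E : Ω → Prop} {ω : Ω} (h : E ω) : p ω ≤ pr p E := by
  have := Finset.single_le_sum (f := fun ω => if E ω then p ω else 0)
    (fun ω _ => by split_ifs <;> simp [hp.nonneg ω]) (Finset.mem_univ ω)
  simp only [h, if_true] at this
  exact this

lemma pr_congr {E F : Ω → Prop} (h : ∀ ω, E ω ↔ F ω) : pr p E = pr p F := by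
  have : E = F := funext fun ω => propext (h ω)
  rw [this]

lemma ex_mono (hp : IsPMF p) {f g : Ω → ℝ} (h : ∀ ω, f ω ≤ g ω) : ex p f ≤ ex p g :=
  Finset.sum_le_sum fun ω _ => mul_le_mul_of_nonneg_left (h ω) (hp.nonneg ω)

lemma ex_nonneg (hp : IsPMF p) {f : Ω → ℝ} (h : ∀ ω, 0 ≤ f ω) : 0 ≤ ex p f :=
  Finset.sum_nonneg fun ω _ => mul_nonneg (hp.nonneg ω) (h ω)

lemma ex_congr {f g : Ω → ℝ} (h : ∀ ω, f ω = g ω) : ex p f = ex p g := by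
  rw [funext h]

lemma ex_add (f g : Ω → ℝ) : ex p (fun ω => f ω + g ω) = ex p f + ex p g := by
  simp only [ex, mul_add, Finset.sum_add_distrib]

lemma ex_smul (a : ℝ) (f : Ω → ℝ) : ex p (fun ω => a * f ω) = a * ex p f := by
  simp only [ex, Finset.mul_sum]
  exact Finset.sum_congr rfl fun ω _ => by ring

lemma ex_sum {ι : Type} (s : Finset ι) (f : ι → Ω → ℝ) :
    ex p (fun ω => ∑ i ∈ s, f i ω) = ∑ i ∈ s, ex p (f i) := by
  simp only [ex, Finset.mul_sum]
  exact Finset.sum_comm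

lemma ex_one (hp : IsPMF p) : ex p (fun _ => 1) = 1 := by
  simp [ex, hp.sum_one]

lemma pr_eq_ex (E : Ω → Prop) : pr p E = ex p (fun ω => if E ω then 1 else 0) := by
  simp [pr, ex]

lemma sum_pr_mul {α : Type} [Fintype α] (A : Ω → α) (F : α → ℝ) :
    ∑ a, pr p (fun ω => A ω = a) * F a = ex p (fun ω => F (A ω)) := by
  simp only [pr, ex, Finset.sum_mul]
  rw [Finset.sum_comm]
  refine Finset.sum_congr rfl fun ω _ => ?_
  simp [ite_mul]

lemma ce_det {α : Type} (A : Ω → α) (Z : Ω → ℝ) : Det A (ce p A Z) := by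
  intro ω ω' h
  simp only [ce, h]

lemma Det.ce {α β : Type} {A : Ω → α} {B : Ω → β} (h : Det B A) (Z : Ω → ℝ) :
    Det B (ce p A Z) :=
  fun _ _ hB => ce_det A Z _ _ (h _ _ hB)

/-- A function of `A` can be pulled out of a conditional expectation given `A`. -/
lemma ex_mul_ce (hp : IsPMF p) {α : Type} {A : Ω → α} {g : Ω → ℝ} (hg : Det A g)
    (Z : Ω → ℝ) : ex p (fun ω => g ω * ce p A Z ω) = ex p (fun ω => g ω * Z ω) := by
  have h1 : ∀ ω, p ω * (g ω * ce p A Z ω) = ∑ ω', if A ω' = A ω then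
      p ω * (g ω' * (p ω' * Z ω')) / pr p (fun ω'' => A ω'' = A ω') else 0 := by
    intro ω
    simp only [ce, Finset.sum_div, Finset.mul_sum]
    refine Finset.sum_congr rfl fun ω' _ => ?_
    split_ifs with h
    · rw [hg ω' ω h, h]; ring
    · simp
  simp only [ex, h1]
  rw [Finset.sum_comm]
  refine Finset.sum_congr rfl fun ω' _ => ?_
  have h2 : ∀ ω, (if A ω' = A ω then
      p ω * (g ω' * (p ω' * Z ω')) / pr p (fun ω'' => A ω'' = A ω') else 0) =
      (if A ω = A ω' then p ω else 0) *
        ((g ω' * (p ω' * Z ω')) / pr p (fun ω'' => A ω'' = A ω')) := by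
    intro ω
    by_cases h : A ω = A ω'
    · simp only [h, if_true]; ring
    · simp only [h, Ne.symm h, if_false, zero_mul]
  simp only [h2]
  rw [← Finset.sum_mul]
  change pr p (fun ω => A ω = A ω') * _ = _
  by_cases h : pr p (fun ω => A ω = A ω') = 0
  · have : p ω' = 0 := le_antisymm
      (by rw [← h]; exact le_pr hp (E := fun ω => A ω = A ω') rfl) (hp.nonneg ω')
    simp [h, this]
  · field_simp

lemma sqCond_eq (hp : IsPMF p) {α : Type} (A : Ω → α) (Z : Ω → ℝ) :
    sqCond p A Z = ex p (fun ω => ce p A Z ω * Z ω) := by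
  rw [← ex_mul_ce hp (ce_det A Z)]
  exact ex_congr fun ω => by ring

lemma ex_mul_le (hp : IsPMF p) (f g : Ω → ℝ) :
    2 * ex p (fun ω => f ω * g ω) ≤ ex p (fun ω => f ω ^ 2) + ex p (fun ω => g ω ^ 2) := by
  rw [← ex_smul, ← ex_add]
  exact ex_mono hp fun ω => by nlinarith [sq_nonneg (f ω - g ω)]

lemma sqCond_le (hp : IsPMF p) {α : Type} (A : Ω → α) (Z : Ω → ℝ) :
    sqCond p A Z ≤ ex p (fun ω => Z ω ^ 2) := by
  have h := ex_mul_le hp (ce p A Z) Z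
  rw [← sqCond_eq hp] at h
  change _ ≤ sqCond p A Z + _ at h
  linarith

lemma sqCond_nonneg (hp : IsPMF p) {α : Type} (A : Ω → α) (Z : Ω → ℝ) :
    0 ≤ sqCond p A Z :=
  ex_nonneg hp fun _ => sq_nonneg _

lemma sqCond_mono (hp : IsPMF p) {α β : Type} {A : Ω → α} {B : Ω → β} (h : Det B A)
    (Z : Ω → ℝ) : sqCond p A Z ≤ sqCond p B Z := by
  have h1 := ex_mul_le hp (ce p A Z) (ce p B Z)
  rw [ex_mul_ce hp (h.ce Z), ← sqCond_eq hp] at h1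
  change _ ≤ sqCond p A Z + sqCond p B Z at h1
  linarith

lemma ce_add {α : Type} (A : Ω → α) (Z Z' : Ω → ℝ) (ω : Ω) :
    ce p A (fun ω => Z ω + Z' ω) ω = ce p A Z ω + ce p A Z' ω := by
  simp only [ce, ← add_div, ← Finset.sum_add_distrib]
  congr 1
  refine Finset.sum_congr rfl fun ω' _ => ?_
  split_ifs <;> ring

lemma ce_sum {α ι : Type} (A : Ω → α) (s : Finset ι) (Z : ι → Ω → ℝ) (ω : Ω) :
    ce p A (fun ω => ∑ i ∈ s, Z i ω) ω = ∑ i ∈ s, ce p A (Z i) ω := by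
  simp only [ce, ← Finset.sum_div]
  congr 1
  rw [Finset.sum_comm]
  refine Finset.sum_congr rfl fun ω' _ => ?_
  split_ifs <;> simp [Finset.mul_sum]

lemma sqCond_add {α : Type} (A : Ω → α) (Z Z' : Ω → ℝ) :
    sqCond p A (fun ω => Z ω + Z' ω) =
      sqCond p A Z + sqCond p A Z' + 2 * ex p (fun ω => ce p A Z ω * ce p A Z' ω) := by
  simp only [sqCond, ← ex_smul, ← ex_add]
  exact ex_congr fun ω => by rw [ce_add]; ring

lemma sqCond_add_le (hp : IsPMF p) {α : Type} (A : Ω → α) (Z Z' : Ω → ℝ) :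
    sqCond p A (fun ω => Z ω + Z' ω) ≤ 2 * sqCond p A Z + 2 * sqCond p A Z' := by
  simp only [sqCond, ← ex_smul, ← ex_add]
  exact ex_mono hp fun ω => by
    rw [ce_add]; nlinarith [sq_nonneg (ce p A Z ω - ce p A Z' ω)]

lemma sqCond_sum_le (hp : IsPMF p) {α ι : Type} (A : Ω → α) (s : Finset ι) (Z : ι → Ω → ℝ) :
    sqCond p A (fun ω => ∑ i ∈ s, Z i ω) ≤ s.card * ∑ i ∈ s, sqCond p A (Z i) := by
  simp only [sqCond, ← ex_smul, ← ex_sum]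
  exact ex_mono hp fun ω => by rw [ce_sum]; exact sq_sum_le_card_mul_sum_sq

lemma expSqCond_eq_sqCond {σ : Type} [Fintype σ] (Z : Ω → ℝ) (A : Ω → σ) :
    expSqCond p Z A = sqCond p A Z :=
  sum_pr_mul A fun m => ((∑ ω, if A ω = m then p ω * Z ω else 0) / pr p (fun ω => A ω = m)) ^ 2

/-- Independence, phrased through products of functions. -/
def Indep {α β : Type} (p : Ω → ℝ) (A : Ω → α) (B : Ω → β) : Prop :=
  ∀ (φ : α → ℝ) (ψ : β → ℝ),
    ex p (fun ω => φ (A ω) * ψ (B ω)) = ex p (fun ω => φ (A ω)) * ex p (fun ω => ψ (B ω))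

lemma indep_of_factor (hp : IsPMF p) {α β : Type} [Fintype α] [Fintype β] {A : Ω → α}
    {B : Ω → β} (f g : Ω → ℝ)
    (h : ∀ ω₁ ω₂, pr p (fun ω => A ω = A ω₁ ∧ B ω = B ω₂) = f ω₁ * g ω₂) : Indep p A B := by
  let f' : α → ℝ := fun a => if h : ∃ ω, A ω = a then f h.choose else 0
  let g' : β → ℝ := fun b => if h : ∃ ω, B ω = b then g h.choose else 0
  have hpr : ∀ a b, pr p (fun ω => (A ω, B ω) = (a, b)) = f' a * g' b := by
    intro a b
    by_cases ha : ∃ ω, A ω = a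
    · by_cases hb : ∃ ω, B ω = b
      · simp only [f', g', ha, hb, dif_pos, ← h, ha.choose_spec, hb.choose_spec, Prod.mk.injEq]
      · push Not at hb
        simp [g', hb, pr]
    · push Not at ha
      simp [f', ha, pr]
  have key : ∀ (φ : α → ℝ) (ψ : β → ℝ), ex p (fun ω => φ (A ω) * ψ (B ω)) =
      (∑ a, f' a * φ a) * ∑ b, g' b * ψ b := by
    intro φ ψ
    rw [← sum_pr_mul (fun ω => (A ω, B ω)) (fun z => φ z.1 * ψ z.2), Fintype.sum_prod_type,
      Finset.sum_mul_sum]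
    refine Finset.sum_congr rfl fun a _ => Finset.sum_congr rfl fun b _ => ?_
    rw [hpr]; ring
  intro φ ψ
  have h1 := key φ (fun _ => 1)
  have h2 := key (fun _ => 1) ψ
  have h3 := key (fun _ => 1) (fun _ => 1)
  simp only [mul_one, one_mul, ex_one hp] at h1 h2 h3
  rw [h1, h2, key]
  linear_combination (-(∑ a, f' a * φ a) * ∑ b, g' b * ψ b) * h3.symm

/-- If `A` and `B` are independent and every event `C = c` is a rectangle in `(A, B)`, then
`(C, A)` and `(C, B)` are conditionally independent given `C`. -/
lemma ex_mul_of_rect (hp : IsPMF p) {α β γ : Type} [Fintype γ] {A : Ω → α} {B : Ω → β}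
    {C : Ω → γ} (hAB : Indep p A B)
    (hrect : ∀ c, ∃ (P : α → Prop) (P' : β → Prop), ∀ ω, C ω = c ↔ P (A ω) ∧ P' (B ω))
    {u v : Ω → ℝ} (hu : Det (fun ω => (C ω, A ω)) u) (hv : Det (fun ω => (C ω, B ω)) v) :
    ex p (fun ω => u ω * v ω) = ex p (fun ω => ce p C u ω * v ω) := by
  have hsplit : ∀ F : Ω → ℝ,
      ex p F = ∑ c, ex p (fun ω => if C ω = c then F ω else 0) := by
    intro F
    rw [← ex_sum]
    exact ex_congr fun ω => by simp
  rw [hsplit, hsplit (fun ω => ce p C u ω * v ω)]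
  refine Finset.sum_congr rfl fun c _ => ?_
  obtain ⟨P, P', hP⟩ := hrect c
  let F : α → ℝ := fun a => if h : ∃ ω, C ω = c ∧ A ω = a then u h.choose else 0
  let G : β → ℝ := fun b => if h : ∃ ω, C ω = c ∧ B ω = b then v h.choose else 0
  have hF : ∀ ω, C ω = c → u ω = F (A ω) := by
    intro ω hω
    have h : ∃ ω', C ω' = c ∧ A ω' = A ω := ⟨ω, hω, rfl⟩
    simp only [F, dif_pos h]
    exact hu _ _ (by simp only [h.choose_spec, hω])
  have hG : ∀ ω, C ω = c → v ω = G (B ω) := by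
    intro ω hω
    have h : ∃ ω', C ω' = c ∧ B ω' = B ω := ⟨ω, hω, rfl⟩
    simp only [G, dif_pos h]
    exact hv _ _ (by simp only [h.choose_spec, hω])
  have hprod : ∀ (s t : Ω → ℝ) (s' : α → ℝ) (t' : β → ℝ),
      (∀ ω, C ω = c → s ω = s' (A ω)) → (∀ ω, C ω = c → t ω = t' (B ω)) →
      ex p (fun ω => if C ω = c then s ω * t ω else 0) =
        ex p (fun ω => if P (A ω) then s' (A ω) else 0) *
          ex p (fun ω => if P' (B ω) then t' (B ω) else 0) := by
    intro s t s' t' hs ht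
    rw [← hAB (fun a => if P a then s' a else 0) (fun b => if P' b then t' b else 0)]
    refine ex_congr fun ω => ?_
    by_cases hc : C ω = c
    · have := (hP ω).1 hc
      simp [hc, this, hs ω hc, ht ω hc]
    · have := mt (hP ω).2 hc
      by_cases h1 : P (A ω) <;> by_cases h2 : P' (B ω) <;> simp_all
  have huv := hprod u v F G hF hG
  have h_u := hprod u (fun _ => 1) F (fun _ => 1) hF (fun _ _ => rfl)
  have h_v := hprod (fun _ => 1) v (fun _ => 1) G (fun _ _ => rfl) hG
  have h_one := hprod (fun _ => 1) (fun _ => 1) (fun _ => 1) (fun _ => 1)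
    (fun _ _ => rfl) (fun _ _ => rfl)
  simp only [mul_one, one_mul] at h_u h_v h_one
  rw [← pr_eq_ex] at h_one
  have hce : ex p (fun ω => if C ω = c then ce p C u ω * v ω else 0) =
      ex p (fun ω => if C ω = c then u ω else 0) / pr p (fun ω => C ω = c) *
        ex p (fun ω => if C ω = c then v ω else 0) := by
    rw [← ex_smul]
    refine ex_congr fun ω => ?_
    split_ifs with hc
    · simp only [ce, hc, ex, mul_ite, mul_zero]
    · simp
  rw [hce]
  by_cases h0 : pr p (fun ω => C ω = c) = 0
  · rw [h0, div_zero, zero_mul]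
    refine Finset.sum_eq_zero fun ω _ => ?_
    by_cases hc : C ω = c
    · have : p ω = 0 := le_antisymm
        (by rw [← h0]; exact le_pr hp (E := fun ω => C ω = c) hc) (hp.nonneg ω)
      simp [this]
    · simp [hc]
  · rw [huv, div_mul_eq_mul_div, eq_div_iff h0, h_u, h_v, h_one]
    ring

end FiniteProbability

section Entropy

variable {Ω : Type} [Fintype Ω] {p : Ω → ℝ}

/-- Shannon entropy in nats, written as an expectation over the sample space. -/
def ent {α : Type} (p : Ω → ℝ) (A : Ω → α) : ℝ :=
  ex p (fun ω => -Real.log (pr p (fun ω' => A ω' = A ω)))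

lemma ex_mono_of_pos (hp : IsPMF p) {f g : Ω → ℝ} (h : ∀ ω, 0 < p ω → f ω ≤ g ω) :
    ex p f ≤ ex p g := by
  refine Finset.sum_le_sum fun ω _ => ?_
  rcases (hp.nonneg ω).eq_or_lt with h0 | h0
  · simp [← h0]
  · exact mul_le_mul_of_nonneg_left (h ω h0) h0.le

lemma ex_congr_of_pos (hp : IsPMF p) {f g : Ω → ℝ} (h : ∀ ω, 0 < p ω → f ω = g ω) :
    ex p f = ex p g :=
  le_antisymm (ex_mono_of_pos hp fun ω hω => (h ω hω).le)
    (ex_mono_of_pos hp fun ω hω => (h ω hω).ge)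

lemma pr_pos (hp : IsPMF p) {E : Ω → Prop} {ω : Ω} (hω : 0 < p ω) (h : E ω) : 0 < pr p E :=
  hω.trans_le (le_pr hp h)

lemma ent_mono (hp : IsPMF p) {α β : Type} {A : Ω → α} {B : Ω → β} (h : Det B A) :
    ent p A ≤ ent p B :=
  ex_mono_of_pos hp fun ω hω => neg_le_neg <|
    Real.log_le_log (pr_pos hp hω rfl) (pr_mono hp fun ω' h' => h ω' ω h')

lemma ent_congr (hp : IsPMF p) {α β : Type} {A : Ω → α} {B : Ω → β} (h : Det B A)
    (h' : Det A B) : ent p A = ent p B :=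
  le_antisymm (ent_mono hp h) (ent_mono hp h')

lemma ent_const (hp : IsPMF p) {α : Type} {A : Ω → α} (h : ∀ ω ω', A ω = A ω') :
    ent p A = 0 := by
  have : ∀ ω, pr p (fun ω' => A ω' = A ω) = 1 := fun ω => by
    rw [pr_congr (F := fun _ => True) fun ω' => by simp [h ω' ω]]
    simp [pr, hp.sum_one]
  simp [ent, this, ex]

lemma H_mul_log_two {α : Type} [Fintype α] (A : Ω → α) : H p A * Real.log 2 = ent p A := by
  have h2 : Real.log 2 ≠ 0 := (Real.log_pos one_lt_two).ne'
  rw [ent, ← sum_pr_mul A fun a => -Real.log (pr p (fun ω' => A ω' = a)), H, neg_mul,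
    Finset.sum_mul, ← Finset.sum_neg_distrib]
  refine Finset.sum_congr rfl fun a _ => ?_
  rw [Real.logb]
  field_simp

lemma condMI_mul_log_two (hp : IsPMF p) {α β γ : Type} [Fintype α] [Fintype β] [Fintype γ]
    (A : Ω → α) (B : Ω → β) (C : Ω → γ) :
    condMI p A B C * Real.log 2 = ent p (fun ω => (A ω, C ω)) + ent p (fun ω => (B ω, C ω)) -
      ent p (fun ω => (A ω, B ω, C ω)) - ent p C := by
  have h2 : Real.log 2 ≠ 0 := (Real.log_pos one_lt_two).ne'
  have h := sum_pr_mul (p := p) (fun ω => (A ω, B ω, C ω)) (fun z =>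
    Real.log ((pr p (fun ω => C ω = z.2.2) *
      pr p (fun ω => A ω = z.1 ∧ B ω = z.2.1 ∧ C ω = z.2.2)) /
      (pr p (fun ω => A ω = z.1 ∧ C ω = z.2.2) * pr p (fun ω => B ω = z.2.1 ∧ C ω = z.2.2))))
  have hL : condMI p A B C * Real.log 2 = ex p (fun ω =>
      Real.log ((pr p (fun ω' => C ω' = C ω) *
        pr p (fun ω' => A ω' = A ω ∧ B ω' = B ω ∧ C ω' = C ω)) /
      (pr p (fun ω' => A ω' = A ω ∧ C ω' = C ω) *
        pr p (fun ω' => B ω' = B ω ∧ C ω' = C ω)))) := by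
    rw [← h]
    simp only [Fintype.sum_prod_type, condMI, Finset.sum_mul, Prod.mk.injEq]
    refine Finset.sum_congr rfl fun a _ => Finset.sum_congr rfl fun b _ =>
      Finset.sum_congr rfl fun c _ => ?_
    rw [Real.logb]
    field_simp
  rw [hL]
  simp only [ent, sub_eq_add_neg, ← neg_one_mul (ex p _), ← ex_smul, ← ex_add, Prod.mk.injEq]
  refine ex_congr_of_pos hp fun ω hω => ?_
  have h1 := (pr_pos hp (E := fun ω' => C ω' = C ω) hω rfl).ne'
  have h2 := (pr_pos hp (E := fun ω' => A ω' = A ω ∧ B ω' = B ω ∧ C ω' = C ω) hω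
    ⟨rfl, rfl, rfl⟩).ne'
  have h3 := (pr_pos hp (E := fun ω' => A ω' = A ω ∧ C ω' = C ω) hω ⟨rfl, rfl⟩).ne'
  have h4 := (pr_pos hp (E := fun ω' => B ω' = B ω ∧ C ω' = C ω) hω ⟨rfl, rfl⟩).ne'
  rw [Real.log_div (mul_ne_zero h1 h2) (mul_ne_zero h3 h4), Real.log_mul h1 h2,
    Real.log_mul h3 h4]
  ring

lemma sum_pr_and {α : Type} [Fintype α] (A : Ω → α) (E : Ω → Prop) :
    ∑ a, pr p (fun ω => A ω = a ∧ E ω) = pr p E := by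
  simp only [pr]
  rw [Finset.sum_comm]
  refine Finset.sum_congr rfl fun ω _ => ?_
  by_cases h : E ω <;> simp [h]

/-- Submodularity of Shannon entropy. -/
lemma ent_submod (hp : IsPMF p) {α β γ : Type} [Fintype α] [Fintype β] [Fintype γ]
    (A : Ω → α) (B : Ω → β) (C : Ω → γ) :
    ent p (fun ω => (A ω, B ω, C ω)) + ent p C ≤
      ent p (fun ω => (A ω, C ω)) + ent p (fun ω => (B ω, C ω)) := by
  let F : α × β × γ → ℝ := fun z =>
    pr p (fun ω => A ω = z.1 ∧ C ω = z.2.2) * pr p (fun ω => B ω = z.2.1 ∧ C ω = z.2.2) /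
      (pr p (fun ω => C ω = z.2.2) * pr p (fun ω => A ω = z.1 ∧ B ω = z.2.1 ∧ C ω = z.2.2))
  have hF : ex p (fun ω => F (A ω, B ω, C ω)) ≤ 1 := by
    rw [← sum_pr_mul (fun ω => (A ω, B ω, C ω)) F, Fintype.sum_prod_type]
    calc ∑ a, ∑ z : β × γ, pr p (fun ω => (A ω, B ω, C ω) = (a, z)) * F (a, z)
        ≤ ∑ a, ∑ z : β × γ, pr p (fun ω => A ω = a ∧ C ω = z.2) *
            pr p (fun ω => B ω = z.1 ∧ C ω = z.2) / pr p (fun ω => C ω = z.2) := by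
          refine Finset.sum_le_sum fun a _ => Finset.sum_le_sum fun z _ => ?_
          obtain ⟨b, c⟩ := z
          simp only [F, Prod.mk.injEq]
          by_cases h : pr p (fun ω => A ω = a ∧ B ω = b ∧ C ω = c) = 0
          · rw [h, zero_mul]
            exact div_nonneg (mul_nonneg (pr_nonneg hp _) (pr_nonneg hp _)) (pr_nonneg hp _)
          · refine le_of_eq ?_
            rw [mul_div_assoc', mul_comm (pr p fun ω => C ω = c), mul_div_mul_left _ _ h]
      _ = 1 := by
          simp only [Fintype.sum_prod_type]
          rw [Finset.sum_comm]
          have : ∀ b c, ∑ a, pr p (fun ω => A ω = a ∧ C ω = c) *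
              pr p (fun ω => B ω = b ∧ C ω = c) / pr p (fun ω => C ω = c) =
              pr p (fun ω => B ω = b ∧ C ω = c) := by
            intro b c
            rw [← Finset.sum_div, ← Finset.sum_mul, sum_pr_and]
            by_cases h : pr p (fun ω => C ω = c) = 0
            · rw [h, zero_mul, zero_div]
              exact le_antisymm (pr_nonneg hp _) (h ▸ pr_mono hp fun ω hω => hω.2)
            · field_simp
          have h' : ∀ b, ∑ a, ∑ c, pr p (fun ω => A ω = a ∧ C ω = c) *
              pr p (fun ω => B ω = b ∧ C ω = c) / pr p (fun ω => C ω = c) =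
              ∑ c, pr p (fun ω => B ω = b ∧ C ω = c) := by
            intro b
            rw [Finset.sum_comm]
            exact Finset.sum_congr rfl fun c _ => this b c
          simp only [h']
          rw [Finset.sum_comm]
          simp only [sum_pr_and]
          simpa [ex_one hp] using sum_pr_mul (p := p) C (fun _ => 1)
  have hlog : ent p (fun ω => (A ω, B ω, C ω)) + ent p C -
      ent p (fun ω => (A ω, C ω)) - ent p (fun ω => (B ω, C ω)) ≤
      ex p (fun ω => F (A ω, B ω, C ω) + (-1) * 1) := by
    simp only [ent, sub_eq_add_neg, ← neg_one_mul (ex p _), ← ex_smul, ← ex_add]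
    simp only [Prod.mk.injEq]
    refine ex_mono_of_pos hp fun ω hω => ?_
    have h1 := pr_pos hp (E := fun ω' => C ω' = C ω) hω rfl
    have h2 := pr_pos hp (E := fun ω' => A ω' = A ω ∧ B ω' = B ω ∧ C ω' = C ω) hω
      ⟨rfl, rfl, rfl⟩
    have h3 := pr_pos hp (E := fun ω' => A ω' = A ω ∧ C ω' = C ω) hω ⟨rfl, rfl⟩
    have h4 := pr_pos hp (E := fun ω' => B ω' = B ω ∧ C ω' = C ω) hω ⟨rfl, rfl⟩
    have := Real.log_le_sub_one_of_pos (div_pos (mul_pos h3 h4) (mul_pos h1 h2))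
    rw [Real.log_div (mul_pos h3 h4).ne' (mul_pos h1 h2).ne', Real.log_mul h1.ne' h2.ne',
      Real.log_mul h3.ne' h4.ne'] at this
    simp only [F]
    linarith
  rw [ex_add, ex_smul, ex_one hp] at hlog
  linarith

lemma ent_pair_le (hp : IsPMF p) {α β : Type} [Fintype α] [Fintype β] (A : Ω → α)
    (B : Ω → β) : ent p (fun ω => (A ω, B ω)) ≤ ent p A + ent p B := by
  have h := ent_submod hp A B (fun _ => ())
  rw [ent_const hp (A := fun _ => ()) fun _ _ => rfl,
    ent_congr hp (A := fun ω => (A ω, B ω, ())) (B := fun ω => (A ω, B ω))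
      (fun _ _ h => by simpa using h) (fun _ _ h => by simpa using h),
    ent_congr hp (A := fun ω => (A ω, ())) (B := A)
      (fun _ _ h => by simpa using h) (fun _ _ h => by simpa using h),
    ent_congr hp (A := fun ω => (B ω, ())) (B := B)
      (fun _ _ h => by simpa using h) (fun _ _ h => by simpa using h)] at h
  linarith

lemma ent_pi_le (hp : IsPMF p) {α : Type} [Fintype α] (k : ℕ) (A : ℕ → Ω → α) :
    ent p (fun ω => fun i : Fin k => A i ω) ≤ ∑ i ∈ Finset.range k, ent p (A i) := by
  induction k with
  | zero => simp [ent_const hp (A := fun ω => fun i : Fin 0 => A i ω) fun _ _ =>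
      Subsingleton.elim _ _]
  | succ k ih =>
    rw [Finset.sum_range_succ]
    refine le_trans (ent_mono hp (B := fun ω => ((fun i : Fin k => A i ω), A k ω)) ?_)
      ((ent_pair_le hp _ _).trans (add_le_add_left ih _))
    intro ω ω' h
    simp only [Prod.mk.injEq] at h
    funext i
    rcases Nat.lt_succ_iff_lt_or_eq.1 i.2 with hi | hi
    · exact congrFun h.1 ⟨i, hi⟩
    · simpa only [hi] using h.2

lemma ent_indep (hp : IsPMF p) {α β : Type} {A : Ω → α} {B : Ω → β} (h : Indep p A B) :
    ent p (fun ω => (A ω, B ω)) = ent p A + ent p B := by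
  simp only [ent, ← ex_add]
  refine ex_congr_of_pos hp fun ω hω => ?_
  have h1 : pr p (fun ω' => (A ω', B ω') = (A ω, B ω)) =
      pr p (fun ω' => A ω' = A ω) * pr p (fun ω' => B ω' = B ω) := by
    simp only [pr_eq_ex]
    rw [← h (fun a => if a = A ω then 1 else 0) (fun b => if b = B ω then 1 else 0)]
    refine ex_congr fun ω' => ?_
    by_cases h1 : A ω' = A ω <;> by_cases h2 : B ω' = B ω <;> simp [h1, h2]
  rw [h1, Real.log_mul (pr_pos hp (E := fun ω' => A ω' = A ω) hω rfl).ne'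
    (pr_pos hp (E := fun ω' => B ω' = B ω) hω rfl).ne', neg_add]

lemma two_mul_sub_two_mul_sqrt_le {x : ℝ} (hx : 0 ≤ x) :
    2 * x - 2 * √x ≤ x * Real.log x := by
  rcases hx.eq_or_lt with h | h
  · simp [← h]
  · have hs := Real.sqrt_pos.2 h
    have h1 := Real.one_sub_inv_le_log_of_pos hs
    have h2 : x * Real.log x = 2 * (√x * √x) * Real.log √x := by
      rw [Real.log_sqrt h.le, Real.mul_self_sqrt h.le]; ring
    rw [h2]
    have h3 : 2 * x - 2 * √x = 2 * (√x * √x) * (1 - (√x)⁻¹) := by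
      rw [mul_sub, mul_one, mul_assoc 2 (√x * √x), mul_assoc (√x), mul_inv_cancel₀ hs.ne',
        Real.mul_self_sqrt h.le, mul_one]
    rw [h3]
    exact mul_le_mul_of_nonneg_left h1 (by positivity)

/-- A form of Pinsker's inequality for a biased coin. -/
lemma sq_div_two_le_mul_log {t : ℝ} (h1 : -1 ≤ t) (h2 : t ≤ 1) :
    t ^ 2 / 2 ≤ (1 + t) * Real.log (1 + t) + (1 - t) * Real.log (1 - t) := by
  have ha := two_mul_sub_two_mul_sqrt_le (x := 1 + t) (by linarith)
  have hb := two_mul_sub_two_mul_sqrt_le (x := 1 - t) (by linarith)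
  have hu := Real.sqrt_nonneg (1 + t)
  have hv := Real.sqrt_nonneg (1 - t)
  have hu2 := Real.sq_sqrt (show 0 ≤ 1 + t by linarith)
  have hv2 := Real.sq_sqrt (show 0 ≤ 1 - t by linarith)
  set u := √(1 + t)
  set v := √(1 - t)
  have huv : u * v ≤ 1 - t ^ 2 / 2 := by
    refine le_of_sq_le_sq ?_ (by nlinarith)
    rw [mul_pow, hu2, hv2]
    nlinarith [sq_nonneg (t ^ 2)]
  have hs : u + v ≤ 2 - t ^ 2 / 4 := by
    refine le_of_sq_le_sq ?_ (by nlinarith)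
    nlinarith [sq_nonneg (t ^ 2)]
  linarith

/-- Pinsker's inequality for a coin `B` with side information `D`. -/
lemma sqCond_coin_le (hp : IsPMF p) {δ : Type} [Fintype δ] (B : Ω → Bool) (D : Ω → δ) :
    sqCond p D (fun ω => coin (B ω)) ≤
      4 * (Real.log 2 + ent p D - ent p (fun ω => (B ω, D ω))) := by
  set x : Ω → ℝ := fun ω => coin (B ω)
  set t := ce p D x
  have hx : ∀ ω, x ω = 1 ∨ x ω = -1 := fun ω => by
    simp only [x, coin]; cases B ω <;> simp
  have hprob : ∀ ω, 0 < p ω → pr p (fun ω' => B ω' = B ω ∧ D ω' = D ω) =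
      pr p (fun ω' => D ω' = D ω) * ((1 + x ω * t ω) / 2) := by
    intro ω hω
    have hD := (pr_pos hp (E := fun ω' => D ω' = D ω) hω rfl).ne'
    have ht : pr p (fun ω' => D ω' = D ω) * t ω =
        ∑ ω', if D ω' = D ω then p ω' * x ω' else 0 := by
      simp only [t, ce]; field_simp
    have : pr p (fun ω' => D ω' = D ω) * ((1 + x ω * t ω) / 2) =
        (pr p (fun ω' => D ω' = D ω) +
          x ω * ∑ ω', if D ω' = D ω then p ω' * x ω' else 0) / 2 := by rw [← ht]; ring
    rw [this]
    simp only [pr, Finset.mul_sum, ← Finset.sum_add_distrib, Finset.sum_div]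
    refine Finset.sum_congr rfl fun ω' _ => ?_
    by_cases h : D ω' = D ω
    · simp only [h, and_true, if_true, x, coin]
      cases B ω <;> cases B ω' <;> simp
    · simp [h]
  have hbound : ∀ ω, 0 < p ω → -1 ≤ t ω ∧ t ω ≤ 1 := by
    intro ω hω
    have hD := pr_pos hp (E := fun ω' => D ω' = D ω) hω rfl
    simp only [t, ce]
    rw [le_div_iff₀ hD, div_le_iff₀ hD, pr]
    simp only [Finset.mul_sum]
    constructor <;> refine Finset.sum_le_sum fun ω' _ => ?_ <;> split_ifs <;>
      first
        | (rcases hx ω' with h | h <;> rw [h] <;> linarith [hp.nonneg ω'])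
        | simp
  have hdet : Det D t := ce_det D x
  let L0 : Ω → ℝ := fun ω => (Real.log (1 + t ω) + Real.log (1 - t ω)) / 2
  let L1 : Ω → ℝ := fun ω => (Real.log (1 + t ω) - Real.log (1 - t ω)) / 2
  have hL1 : Det D L1 := fun ω ω' h => by simp only [L1, hdet ω ω' h]
  have hent : Real.log 2 + ent p D - ent p (fun ω => (B ω, D ω)) =
      ex p (fun ω => L0 ω + L1 ω * x ω) := by
    have h2 : Real.log 2 = ex p (fun _ => Real.log 2 * 1) := by rw [ex_smul, ex_one hp, mul_one]
    rw [h2]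
    simp only [ent, sub_eq_add_neg, ← neg_one_mul (ex p _), ← ex_smul, ← ex_add, Prod.mk.injEq]
    refine ex_congr_of_pos hp fun ω hω => ?_
    have hD := (pr_pos hp (E := fun ω' => D ω' = D ω) hω rfl).ne'
    have hBD := (pr_pos hp (E := fun ω' => B ω' = B ω ∧ D ω' = D ω) hω ⟨rfl, rfl⟩).ne'
    rw [hprob ω hω] at hBD ⊢
    have h1 : 1 + x ω * t ω ≠ 0 := fun h => hBD (by rw [h]; ring)
    rw [Real.log_mul hD (div_ne_zero h1 two_ne_zero), Real.log_div h1 two_ne_zero]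
    simp only [L0, L1]
    rcases hx ω with h | h <;> rw [h]
    · ring_nf
    · ring_nf
  rw [hent, ex_add, ← ex_mul_ce hp hL1, ← ex_add, ← ex_smul, sqCond]
  refine ex_mono_of_pos hp fun ω hω => ?_
  have := sq_div_two_le_mul_log (hbound ω hω).1 (hbound ω hω).2
  change t ω ^ 2 ≤ 4 * (L0 ω + L1 ω * t ω)
  simp only [L0, L1]
  linarith

end Entropy

section Walk

variable {Ω : Type} {X : ℕ → Ω → Bool}

/-- The sum of the coins with indices in `[a, b)`. -/
def walk (X : ℕ → Ω → Bool) (a b : ℕ) (ω : Ω) : ℝ := ∑ l ∈ Finset.Ico a b, coin (X l ω)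

lemma walk_add {a b c : ℕ} (hab : a ≤ b) (hbc : b ≤ c) (ω : Ω) :
    walk X a c ω = walk X a b ω + walk X b c ω :=
  (Finset.sum_Ico_consecutive _ hab hbc).symm

end Walk

section Streaming

variable {Ω : Type} [Fintype Ω] {p : Ω → ℝ} {n k : ℕ} {X : ℕ → Ω → Bool}

lemma Det.exists_eq {α : Type} {A : Ω → α} {u : Ω → ℝ} (h : Det A u) :
    ∃ φ : α → ℝ, ∀ ω, u ω = φ (A ω) := by
  refine ⟨fun a => if h : ∃ ω, A ω = a then u h.choose else 0, fun ω => ?_⟩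
  have hω : ∃ ω', A ω' = A ω := ⟨ω, rfl⟩
  simp only [dif_pos hω]
  exact h _ _ hω.choose_spec.symm

lemma Indep.ex_mul {α β : Type} {A : Ω → α} {B : Ω → β} (h : Indep p A B) {u v : Ω → ℝ}
    (hu : Det A u) (hv : Det B v) :
    ex p (fun ω => u ω * v ω) = ex p u * ex p v := by
  obtain ⟨φ, hφ⟩ := hu.exists_eq
  obtain ⟨ψ, hψ⟩ := hv.exists_eq
  rw [funext hφ, funext hψ]
  exact h φ ψ

/-- The parallel memory states `M_{(≤k, j)}`. -/
def Alg.par (M : Alg Ω p Bool n k X) (j : ℕ) (ω : Ω) : Fin k → M.S :=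
  fun i => M.st i j ω

/-- The states `M_{<k}` at the beginning of the passes. -/
def Alg.starts (M : Alg Ω p Bool n k X) (ω : Ω) : Fin k → M.S :=
  fun i => M.passEnd i ω

/-- The conditioning in the information cost: `(M_{<k}, M_{(≤k, j)})`. -/
def Alg.ctx (M : Alg Ω p Bool n k X) (j : ℕ) (ω : Ω) : (Fin k → M.S) × (Fin k → M.S) :=
  (M.starts ω, M.par j ω)

/-- The initial state together with all inputs and seeds of the first `a` steps. -/
def Alg.past (M : Alg Ω p Bool n k X) (a : ℕ) (ω : Ω) :
    M.S × (Fin a → Bool × (Fin k → M.Rv)) :=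
  (M.init ω, fun j => (X j ω, fun i => M.R i j ω))

/-- All inputs and seeds of the steps after the first `a`. -/
def Alg.fut (M : Alg Ω p Bool n k X) (a : ℕ) (ω : Ω) :
    Fin (n - a) → Bool × (Fin k → M.Rv) :=
  fun j => (X (a + j) ω, fun i => M.R i (a + j) ω)

/-- Running pass `i` for `t` steps from state `s` at time `a`. -/
def Alg.seg (M : Alg Ω p Bool n k X) (i a : ℕ) (s : M.S) : ℕ → Ω → M.S
  | 0, _ => s
  | t + 1, ω => M.f i (a + t) (X (a + t) ω) (M.seg i a s t ω) (M.R i (a + t) ω)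

lemma Alg.past_eq_iff (M : Alg Ω p Bool n k X) {a : ℕ} {ω ω' : Ω} :
    M.past a ω = M.past a ω' ↔ M.init ω = M.init ω' ∧
      ∀ j < a, X j ω = X j ω' ∧ ∀ i < k, M.R i j ω = M.R i j ω' := by
  simp only [Alg.past, Prod.mk.injEq, funext_iff, Fin.forall_iff]

lemma Alg.fut_eq_iff (M : Alg Ω p Bool n k X) {a : ℕ} {ω ω' : Ω} :
    M.fut a ω = M.fut a ω' ↔
      ∀ j, a ≤ j → j < n → X j ω = X j ω' ∧ ∀ i < k, M.R i j ω = M.R i j ω' := by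
  simp only [Alg.fut, Prod.mk.injEq, funext_iff, Fin.forall_iff]
  constructor
  · intro h j hj hjn
    have := h (j - a) (by omega)
    rwa [Nat.add_sub_cancel' hj] at this
  · intro h j hj
    exact h (a + j) (by omega) (by omega)

lemma Alg.seg_congr (M : Alg Ω p Bool n k X) {i a t : ℕ} (s : M.S) {ω ω' : Ω}
    (h : ∀ j, a ≤ j → j < a + t → X j ω = X j ω' ∧ M.R i j ω = M.R i j ω') :
    M.seg i a s t ω = M.seg i a s t ω' := by
  induction t with
  | zero => rfl
  | succ t ih =>
    simp only [Alg.seg]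
    rw [ih fun j hj hj' => h j hj (by omega), (h (a + t) (by omega) (by omega)).1,
      (h (a + t) (by omega) (by omega)).2]

lemma Alg.st_add (M : Alg Ω p Bool n k X) {i a t : ℕ} (hi : i < k) (h : a + t ≤ n) (ω : Ω) :
    M.st i (a + t) ω = M.seg i a (M.st i a ω) t ω := by
  induction t with
  | zero => rfl
  | succ t ih =>
    have : a + t < n := by omega
    simp only [Alg.seg, ← ih (by omega)]
    exact if_pos ⟨this, hi⟩

lemma Alg.st_eq_seg (M : Alg Ω p Bool n k X) {i a : ℕ} (hi : i < k) (h : a ≤ n) (ω : Ω) :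
    M.st i a ω = M.seg i 0 (M.passEnd i ω) a ω := by
  have := M.st_add (i := i) (a := 0) (t := a) hi (by omega) ω
  rwa [zero_add] at this

lemma Alg.det_par_past (M : Alg Ω p Bool n k X) {a : ℕ} (h : a ≤ n) :
    Det (fun ω => (M.starts ω, M.past a ω)) (M.par a) := by
  intro ω ω' hω
  simp only [Prod.mk.injEq, M.past_eq_iff] at hω
  funext i
  simp only [Alg.par]
  rw [M.st_eq_seg i.2 h, M.st_eq_seg i.2 h, show M.passEnd i ω = M.passEnd i ω' from
    congrFun hω.1 i]
  exact M.seg_congr _ fun j _ hj => ⟨(hω.2.2 j (by omega)).1, (hω.2.2 j (by omega)).2 i i.2⟩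

lemma Alg.det_par_fut (M : Alg Ω p Bool n k X) {a b : ℕ} (hab : a ≤ b) (h : b ≤ n) :
    Det (fun ω => (M.ctx a ω, M.fut a ω)) (M.par b) := by
  intro ω ω' hω
  simp only [Prod.mk.injEq, M.fut_eq_iff, Alg.ctx] at hω
  obtain ⟨t, rfl⟩ := Nat.exists_eq_add_of_le hab
  funext i
  simp only [Alg.par]
  rw [M.st_add i.2 h, M.st_add i.2 h, show M.st i a ω = M.st i a ω' from
    congrFun hω.1.2 i]
  exact M.seg_congr _ fun j hj hj' =>
    ⟨(hω.2 j hj (by omega)).1, (hω.2 j hj (by omega)).2 i i.2⟩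

lemma Alg.ctx_rect (M : Alg Ω p Bool n k X) {a : ℕ} (ha : a ≤ n)
    (c : (Fin k → M.S) × (Fin k → M.S)) :
    ∃ (P : M.S × (Fin a → Bool × (Fin k → M.Rv)) → Prop)
      (P' : (Fin (n - a) → Bool × (Fin k → M.Rv)) → Prop),
      ∀ ω, M.ctx a ω = c ↔ P (M.past a ω) ∧ P' (M.fut a ω) := by
  obtain ⟨w, y⟩ := c
  let P₀ : Ω → Prop := fun ω => (∀ h : 0 < k, M.init ω = w ⟨0, h⟩) ∧
    ∀ i : Fin k, M.seg i 0 (w i) a ω = y i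
  let P₁ : Ω → Prop := fun ω => ∀ i (h : i + 1 < k),
    M.seg i a (y ⟨i, by omega⟩) (n - a) ω = w ⟨i + 1, h⟩
  refine ⟨fun z => ∃ ω, M.past a ω = z ∧ P₀ ω, fun z => ∃ ω, M.fut a ω = z ∧ P₁ ω,
    fun ω => ?_⟩
  have h0 : (∃ ω', M.past a ω' = M.past a ω ∧ P₀ ω') ↔ P₀ ω := by
    refine ⟨?_, fun h => ⟨ω, rfl, h⟩⟩
    rintro ⟨ω', h, h1, h2⟩
    rw [M.past_eq_iff] at h
    refine ⟨fun hk => h.1 ▸ h1 hk, fun i => ?_⟩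
    rw [← h2 i]
    exact M.seg_congr _ fun j _ hj =>
      ⟨(h.2 j (by omega)).1.symm, ((h.2 j (by omega)).2 i i.2).symm⟩
  have h1 : (∃ ω', M.fut a ω' = M.fut a ω ∧ P₁ ω') ↔ P₁ ω := by
    refine ⟨?_, fun h => ⟨ω, rfl, h⟩⟩
    rintro ⟨ω', h, h1⟩
    rw [M.fut_eq_iff] at h
    intro i hi
    rw [← h1 i hi]
    exact M.seg_congr _ fun j hj hj' =>
      ⟨(h j hj (by omega)).1.symm, ((h j hj (by omega)).2 i (by omega)).symm⟩
  refine Iff.trans ?_ (and_congr h0 h1).symm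
  have hn : a + (n - a) = n := by omega
  constructor
  · intro h
    simp only [Alg.ctx, Prod.mk.injEq] at h
    obtain ⟨rfl, rfl⟩ := h
    refine ⟨⟨fun _ => rfl, fun i => (M.st_eq_seg i.2 ha ω).symm⟩, fun i hi => ?_⟩
    have := M.st_add (i := i) (a := a) (t := n - a) (by omega) hn.le ω
    rw [hn] at this
    exact this.symm
  · rintro ⟨⟨h1, h2⟩, h3⟩
    have hw : ∀ i (hi : i < k), M.passEnd i ω = w ⟨i, hi⟩ := by
      intro i
      induction i with
      | zero => exact fun hi => h1 hi
      | succ i ih =>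
        intro hi
        have := M.st_add (i := i) (a := a) (t := n - a) (by omega) hn.le ω
        rw [hn, M.st_eq_seg (by omega) ha, ih (by omega)] at this
        rw [← h3 i hi, ← h2]
        exact this
    simp only [Alg.ctx, Prod.mk.injEq]
    refine ⟨funext fun i => hw i i.2, funext fun i => ?_⟩
    rw [← h2 i]
    simp only [Alg.par]
    rw [M.st_eq_seg i.2 ha, hw i i.2]

lemma Alg.indep_past_fut (M : Alg Ω p Bool n k X) (hp : IsPMF p) (hX : IsProduct p n X)
    {a : ℕ} (ha : a ≤ n) : Indep p (M.past a) (M.fut a) := by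
  let g : ℕ → Ω → ℝ := fun j ω => (∏ i ∈ Finset.range k, pr p (fun ω' => M.R i j ω' = M.R i j ω)) *
    pr p (fun ω' => X j ω' = X j ω)
  refine indep_of_factor hp
    (fun ω => pr p (fun ω' => M.init ω' = M.init ω) * ∏ j ∈ Finset.range a, g j ω)
    (fun ω => ∏ j ∈ Finset.Ico a n, g j ω) fun ω₁ ω₂ => ?_
  let z : ℕ → Ω := fun j => if j < a then ω₁ else ω₂
  have hev : ∀ ω, (M.past a ω = M.past a ω₁ ∧ M.fut a ω = M.fut a ω₂) ↔
      (M.init ω = M.init ω₁ ∧ (∀ i < k, ∀ j < n, M.R i j ω = M.R i j (z j)) ∧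
        (∀ j < n, X j ω = X j (z j))) := by
    intro ω
    rw [M.past_eq_iff, M.fut_eq_iff]
    constructor
    · rintro ⟨⟨h0, h1⟩, h2⟩
      refine ⟨h0, fun i hi j hj => ?_, fun j hj => ?_⟩ <;> by_cases hja : j < a <;>
        simp only [z, hja, if_true, if_false]
      · exact (h1 j hja).2 i hi
      · exact (h2 j (by omega) hj).2 i hi
      · exact (h1 j hja).1
      · exact (h2 j (by omega) hj).1
    · rintro ⟨h0, h1, h2⟩
      refine ⟨⟨h0, fun j hj => ?_⟩, fun j hj hjn => ?_⟩
      · have hz : z j = ω₁ := by simp [z, hj]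
        exact ⟨hz ▸ h2 j (by omega), fun i hi => hz ▸ h1 i hi j (by omega)⟩
      · have hz : z j = ω₂ := by simp [z, hj]
        exact ⟨hz ▸ h2 j hjn, fun i hi => hz ▸ h1 i hi j hjn⟩
  rw [pr_congr hev, M.indep (M.init ω₁) (fun i j => M.R i j (z j)) (fun j => X j (z j)),
    hX (fun j => X j (z j)), Finset.prod_comm, mul_assoc, ← Finset.prod_mul_distrib, mul_assoc,
    ← Finset.prod_range_mul_prod_Ico _ ha]
  congr 2
  · refine Finset.prod_congr rfl fun j hj => ?_
    simp only [g, z, Finset.mem_range.1 hj, if_true]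
  · refine Finset.prod_congr rfl fun j hj => ?_
    simp only [g, z, (Finset.mem_Ico.1 hj).1.not_gt, if_false]

/-- Past and future are conditionally independent given `M_{<k}` and `M_{(≤k, a)}`. -/
lemma Alg.ex_mul_past_fut (M : Alg Ω p Bool n k X) (hp : IsPMF p) (hX : IsProduct p n X)
    {a : ℕ} (ha : a ≤ n) {u v : Ω → ℝ} (hu : Det (fun ω => (M.ctx a ω, M.past a ω)) u)
    (hv : Det (fun ω => (M.ctx a ω, M.fut a ω)) v) :
    ex p (fun ω => u ω * v ω) = ex p (fun ω => ce p (M.ctx a) u ω * v ω) :=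
  ex_mul_of_rect hp (M.indep_past_fut hp hX ha) (M.ctx_rect ha) hu hv

lemma Alg.det_past (M : Alg Ω p Bool n k X) {a j : ℕ} (h : j < a) :
    Det (M.past a) (X j) :=
  fun _ _ hω => ((M.past_eq_iff.1 hω).2 j h).1

lemma Alg.det_fut (M : Alg Ω p Bool n k X) {a j : ℕ} (h : a ≤ j) (hj : j < n) :
    Det (M.fut a) (X j) :=
  fun _ _ hω => (M.fut_eq_iff.1 hω j h hj).1

lemma Alg.det_walk_past (M : Alg Ω p Bool n k X) (a b : ℕ) :
    Det (M.past b) (walk X a b) := by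
  intro ω ω' h
  refine Finset.sum_congr rfl fun l hl => ?_
  rw [M.det_past (Finset.mem_Ico.1 hl).2 ω ω' h]

lemma Alg.det_walk_fut (M : Alg Ω p Bool n k X) {a b : ℕ} (hb : b ≤ n) :
    Det (M.fut a) (walk X a b) := by
  intro ω ω' h
  refine Finset.sum_congr rfl fun l hl => ?_
  rw [M.det_fut (Finset.mem_Ico.1 hl).1 ((Finset.mem_Ico.1 hl).2.trans_le hb) ω ω' h]

lemma ex_coin {j : ℕ} (h : ∀ b : Bool, pr p (fun ω => X j ω = b) = 1 / 2) :
    ex p (fun ω => coin (X j ω)) = 0 := by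
  rw [← sum_pr_mul (X j) coin]
  simp [h, coin]

lemma ex_walk (hunif : ∀ j < n, ∀ b : Bool, pr p (fun ω => X j ω = b) = 1 / 2) {a b : ℕ}
    (hb : b ≤ n) : ex p (walk X a b) = 0 := by
  change ex p (fun ω => ∑ l ∈ Finset.Ico a b, coin (X l ω)) = 0
  rw [ex_sum]
  exact Finset.sum_eq_zero fun l hl =>
    ex_coin (hunif l ((Finset.mem_Ico.1 hl).2.trans_le hb))

lemma Alg.ex_walk_mul_walk (M : Alg Ω p Bool n k X) (hp : IsPMF p) (hX : IsProduct p n X)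
    (hunif : ∀ j < n, ∀ b : Bool, pr p (fun ω => X j ω = b) = 1 / 2) {a b c : ℕ}
    (hbc : b ≤ c) (hc : c ≤ n) : ex p (fun ω => walk X a b ω * walk X b c ω) = 0 := by
  rw [(M.indep_past_fut hp hX (hbc.trans hc)).ex_mul (M.det_walk_past a b)
    (M.det_walk_fut hc), ex_walk hunif hc, mul_zero]

lemma Alg.ex_walk_sq (M : Alg Ω p Bool n k X) (hp : IsPMF p) (hX : IsProduct p n X)
    (hunif : ∀ j < n, ∀ b : Bool, pr p (fun ω => X j ω = b) = 1 / 2) {a t : ℕ}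
    (h : a + t ≤ n) : ex p (fun ω => walk X a (a + t) ω ^ 2) = t := by
  induction t with
  | zero => simp [walk, ex]
  | succ t ih =>
    have h1 : ∀ ω, walk X a (a + (t + 1)) ω ^ 2 = (walk X a (a + t) ω ^ 2 +
        2 * (walk X a (a + t) ω * walk X (a + t) (a + t + 1) ω)) + 1 := by
      intro ω
      rw [← add_assoc, walk_add (b := a + t) (by omega) (by omega)]
      have : walk X (a + t) (a + t + 1) ω ^ 2 = 1 := by
        simp only [walk, Nat.Ico_succ_singleton, Finset.sum_singleton, coin]
        split_ifs <;> norm_num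
      linear_combination this
    rw [ex_congr h1, ex_add, ex_add, ex_smul,
      M.ex_walk_mul_walk hp hX hunif (c := a + t + 1) (by omega) h, ih (by omega), ex_one hp]
    push_cast; ring

end Streaming

section Information

variable {Ω : Type} [Fintype Ω] {p : Ω → ℝ} {n k : ℕ} {X : ℕ → Ω → Bool}

/-- The summand `I(M_{(≤k, b)}; X_l | M_{<k}, M_{(≤k, l)})` of the information cost. -/
def Alg.info (M : Alg Ω p Bool n k X) (b l : ℕ) : ℝ := condMI p (M.par b) (X l) (M.ctx l)

/-- The information (in nats) that `(M_{<k}, M_{(≤k, l)})` reveals about a uniform `X_l`. -/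
def Alg.leak (M : Alg Ω p Bool n k X) (l : ℕ) : ℝ :=
  Real.log 2 + ent p (M.ctx l) - ent p (fun ω => (X l ω, M.ctx l ω))

lemma Alg.info_nonneg (M : Alg Ω p Bool n k X) (hp : IsPMF p) (b l : ℕ) : 0 ≤ M.info b l := by
  have h1 := condMI_mul_log_two hp (M.par b) (X l) (M.ctx l)
  have h2 := ent_submod hp (M.par b) (X l) (M.ctx l)
  exact nonneg_of_mul_nonneg_left (by rw [Alg.info, h1]; linarith) (Real.log_pos one_lt_two)

lemma Alg.leak_nonneg (M : Alg Ω p Bool n k X) (hp : IsPMF p) (l : ℕ) : 0 ≤ M.leak l := by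
  have h1 := sqCond_coin_le hp (X l) (M.ctx l)
  have h2 := sqCond_nonneg hp (M.ctx l) (fun ω => coin (X l ω))
  rw [Alg.leak]
  linarith

lemma Alg.sqCond_coin_le_info (M : Alg Ω p Bool n k X) (hp : IsPMF p) (b l : ℕ) :
    sqCond p (fun ω => (M.par b ω, M.ctx l ω)) (fun ω => coin (X l ω)) ≤
      4 * (M.leak l + M.info b l * Real.log 2) := by
  have h1 := condMI_mul_log_two hp (M.par b) (X l) (M.ctx l)
  have h2 := sqCond_coin_le hp (X l) (fun ω => (M.par b ω, M.ctx l ω))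
  rw [ent_congr hp (A := fun ω => (X l ω, M.par b ω, M.ctx l ω))
    (B := fun ω => (M.par b ω, X l ω, M.ctx l ω))
    (fun _ _ h => by simp only [Prod.mk.injEq] at h ⊢; tauto)
    (fun _ _ h => by simp only [Prod.mk.injEq] at h ⊢; tauto)] at h2
  rw [Alg.leak, Alg.info]
  linarith

lemma ent_fair_bit (B : Ω → Bool) (hp : IsPMF p)
    (h : ∀ b : Bool, pr p (fun ω => B ω = b) = 1 / 2) : ent p B = Real.log 2 := by
  have : ∀ ω, -Real.log (pr p (fun ω' => B ω' = B ω)) = Real.log 2 * 1 := fun ω => by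
    rw [h, one_div, Real.log_inv]; ring
  rw [ent, ex_congr this, ex_smul, ex_one hp, mul_one]

lemma Alg.det_past_of_le (M : Alg Ω p Bool n k X) {a b : ℕ} (h : a ≤ b) :
    Det (M.past b) (M.past a) := by
  intro ω ω' hω
  rw [M.past_eq_iff] at hω ⊢
  exact ⟨hω.1, fun j hj => hω.2 j (by omega)⟩

lemma Alg.leak_le (M : Alg Ω p Bool n k X) (hp : IsPMF p) (hX : IsProduct p n X)
    (hunif : ∀ j < n, ∀ b : Bool, pr p (fun ω => X j ω = b) = 1 / 2) {l : ℕ} (hl : l < n) :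
    M.leak l ≤ (ent p (fun ω => (M.starts ω, M.past l ω)) - ent p (M.past l)) -
      (ent p (fun ω => (M.starts ω, M.past (l + 1) ω)) - ent p (M.past (l + 1))) := by
  have h1 := ent_submod hp (X l) (M.past l) (M.ctx l)
  have h2 := ent_submod hp M.starts (M.past (l + 1)) (fun ω => (M.past l ω, X l ω))
  have hpar := M.det_par_past hl.le
  have e1 : ent p (fun ω => (X l ω, M.past l ω, M.ctx l ω)) =
      ent p (fun ω => (M.starts ω, M.past l ω, X l ω)) := by
    refine ent_congr hp (fun ω ω' h => ?_) (fun ω ω' h => ?_)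
    · simp only [Prod.mk.injEq, Alg.ctx] at h ⊢
      exact ⟨h.2.2, h.2.1, h.1, hpar ω ω' (by simp only [h])⟩
    · simp only [Prod.mk.injEq, Alg.ctx] at h ⊢
      tauto
  have e2 : ent p (fun ω => (M.past l ω, M.ctx l ω)) =
      ent p (fun ω => (M.starts ω, M.past l ω)) := by
    refine ent_congr hp (fun ω ω' h => ?_) (fun ω ω' h => ?_)
    · have h' := h
      simp only [Prod.mk.injEq, Alg.ctx] at h ⊢
      exact ⟨h.2, h.1, hpar ω ω' h'⟩
    · simp only [Prod.mk.injEq, Alg.ctx] at h ⊢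
      tauto
  have e3 : ent p (fun ω => (M.past l ω, X l ω)) = ent p (M.past l) + Real.log 2 := by
    rw [← ent_fair_bit (X l) hp (hunif l hl)]
    refine ent_indep hp fun φ ψ => ?_
    exact (M.indep_past_fut hp hX hl.le).ex_mul
      (fun ω ω' h => by simp only [h])
      (fun ω ω' h => by simp only [M.det_fut le_rfl hl ω ω' h])
  have hXP : Det (M.past (l + 1)) (fun ω => (M.past l ω, X l ω)) :=
    (M.det_past_of_le (Nat.le_succ l)).prodMk (M.det_past (Nat.lt_succ_self l))
  have e4 : ent p (fun ω => (M.past (l + 1) ω, M.past l ω, X l ω)) = ent p (M.past (l + 1)) :=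
    ent_congr hp (fun ω ω' h => Prod.ext h (hXP ω ω' h))
      (fun ω ω' h => (Prod.mk.inj h).1)
  have e5 : ent p (fun ω => (M.starts ω, M.past (l + 1) ω, M.past l ω, X l ω)) =
      ent p (fun ω => (M.starts ω, M.past (l + 1) ω)) := by
    refine ent_congr hp (fun ω ω' h => ?_) (fun ω ω' h => ?_)
    · simp only [Prod.mk.injEq] at h
      have := hXP ω ω' h.2
      simp only [Prod.mk.injEq] at this ⊢
      exact ⟨h.1, h.2, this⟩
    · simp only [Prod.mk.injEq] at h ⊢
      tauto
  rw [Alg.leak]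
  linarith

lemma Alg.sum_leak_le (M : Alg Ω p Bool n k X) (hp : IsPMF p) (hX : IsProduct p n X)
    (hunif : ∀ j < n, ∀ b : Bool, pr p (fun ω => X j ω = b) = 1 / 2) :
    ∑ l ∈ Finset.range n, M.leak l ≤ ent p M.starts := by
  refine (Finset.sum_le_sum fun l hl =>
    M.leak_le hp hX hunif (Finset.mem_range.1 hl)).trans ?_
  rw [Finset.sum_range_sub' fun l =>
    ent p (fun ω => (M.starts ω, M.past l ω)) - ent p (M.past l)]
  have h1 := ent_pair_le hp M.starts (M.past 0)
  have h2 : ent p (M.past n) ≤ ent p (fun ω => (M.starts ω, M.past n ω)) :=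
    ent_mono hp fun _ _ h => (Prod.mk.inj h).2
  linarith

lemma Alg.ent_starts_le (M : Alg Ω p Bool n k X) (hp : IsPMF p) {B : ℝ}
    (hB : ∀ i ≤ k, H p (M.passEnd i) ≤ B) : ent p M.starts ≤ k * B * Real.log 2 := by
  refine (ent_pi_le hp k M.passEnd).trans ?_
  refine (Finset.sum_le_sum (g := fun _ => B * Real.log 2) fun i hi => ?_).trans_eq ?_
  · rw [← H_mul_log_two]
    exact mul_le_mul_of_nonneg_right (hB i (Finset.mem_range.1 hi).le)
      (Real.log_pos one_lt_two).le
  · simp; ring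

/-- Given the states at time `l`, earlier states carry no information about `X_l`. -/
lemma Alg.sqCond_coin_le_of_le (M : Alg Ω p Bool n k X) (hp : IsPMF p) (hX : IsProduct p n X)
    {a l b : ℕ} (hal : a ≤ l) (hlb : l < b) (hb : b ≤ n) :
    sqCond p (fun ω => (M.ctx a ω, M.par b ω)) (fun ω => coin (X l ω)) ≤
      sqCond p (fun ω => (M.par b ω, M.ctx l ω)) (fun ω => coin (X l ω)) := by
  set x : Ω → ℝ := fun ω => coin (X l ω)
  set g := ce p (fun ω => (M.ctx a ω, M.par b ω)) x
  set D := fun ω => (M.par b ω, M.ctx l ω)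
  have hx : Det (M.fut l) x := fun ω ω' h => by
    simp only [x, M.det_fut le_rfl (hlb.trans_le hb) ω ω' h]
  have hD : Det (fun ω => (M.ctx l ω, M.fut l ω)) D :=
    (M.det_par_fut hlb.le hb).prodMk fun ω ω' h => (Prod.mk.inj h).1
  have hpar : Det (fun ω => (M.ctx l ω, M.past l ω)) (M.par a) := fun ω ω' h => by
    simp only [Prod.mk.injEq, Alg.ctx] at h
    exact M.det_par_past (hal.trans (hlb.le.trans hb)) ω ω'
      (Prod.ext h.1.1 (M.det_past_of_le hal ω ω' h.2))
  have hg : Det (fun ω => (M.par a ω, D ω)) g := Det.ce (fun ω ω' h => by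
    simp only [Prod.mk.injEq, Alg.ctx, D] at h ⊢
    tauto) x
  obtain ⟨φ, hφ⟩ := hg.exists_eq
  have hsplit : ∀ Z : Ω → ℝ, ex p (fun ω => g ω * Z ω) =
      ∑ y, ex p (fun ω => (if M.par a ω = y then 1 else 0) * (φ (y, D ω) * Z ω)) := by
    intro Z
    rw [← ex_sum]
    exact ex_congr fun ω => by simp [hφ]
  have hkey : ex p (fun ω => g ω * x ω) = ex p (fun ω => g ω * ce p D x ω) := by
    rw [hsplit, hsplit]
    refine Finset.sum_congr rfl fun y _ => ?_
    have hu : Det (fun ω => (M.ctx l ω, M.past l ω))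
        (fun ω => if M.par a ω = y then (1 : ℝ) else 0) :=
      fun ω ω' h => by simp only [hpar ω ω' h]
    have hφy : Det D (fun ω => φ (y, D ω)) := fun ω ω' h => by simp only [h]
    have hln : l ≤ n := hlb.le.trans hb
    rw [M.ex_mul_past_fut hp hX hln hu ((hD.trans hφy).mul fun ω ω' h => hx ω ω' (Prod.mk.inj h).2),
      M.ex_mul_past_fut hp hX hln hu ((hD.trans hφy).mul (hD.trans (ce_det D x)))]
    have hcl : Det D (fun ω =>
        ce p (M.ctx l) (fun ω => if M.par a ω = y then (1 : ℝ) else 0) ω * φ (y, D ω)) :=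
      Det.mul (Det.ce (fun ω ω' h => (Prod.mk.inj h).2) _) hφy
    simp only [← mul_assoc]
    exact (ex_mul_ce hp hcl x).symm
  have h := ex_mul_le hp g (ce p D x)
  rw [← hkey, ← sqCond_eq hp] at h
  change _ ≤ sqCond p _ x + sqCond p D x at h
  linarith

lemma Alg.sqCond_walk_le_add (M : Alg Ω p Bool n k X) (hp : IsPMF p) (hX : IsProduct p n X)
    (hunif : ∀ j < n, ∀ b : Bool, pr p (fun ω => X j ω = b) = 1 / 2) {a b : ℕ}
    (hab : a ≤ b) (hb : b ≤ n) :
    sqCond p (M.ctx b) (walk X 0 b) ≤ sqCond p (M.ctx a) (walk X 0 a) +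
      sqCond p (fun ω => (M.ctx a ω, M.par b ω)) (walk X a b) := by
  set D := fun ω => (M.ctx a ω, M.par b ω)
  set S₁ : Ω → ℝ := walk X 0 a
  set S₂ : Ω → ℝ := walk X a b
  have han := hab.trans hb
  have hD : Det (fun ω => (M.ctx a ω, M.fut a ω)) D :=
    Det.prodMk (fun ω ω' h => (Prod.mk.inj h).1) (M.det_par_fut hab hb)
  have hS₁ : Det (fun ω => (M.ctx a ω, M.past a ω)) S₁ :=
    fun ω ω' h => M.det_walk_past 0 a ω ω' (Prod.mk.inj h).2
  have hS₂ : Det (fun ω => (M.ctx a ω, M.fut a ω)) S₂ :=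
    fun ω ω' h => M.det_walk_fut hb ω ω' (Prod.mk.inj h).2
  have hC : Det D (M.ctx a) := fun ω ω' h => (Prod.mk.inj h).1
  have hcross : ex p (fun ω => ce p D S₁ ω * ce p D S₂ ω) = 0 := by
    rw [ex_congr fun ω => mul_comm (ce p D S₁ ω) (ce p D S₂ ω), ex_mul_ce hp (ce_det D S₂),
      ex_congr fun ω => mul_comm (ce p D S₂ ω) (S₁ ω),
      M.ex_mul_past_fut hp hX han hS₁ (hD.trans (ce_det D S₂)), ex_mul_ce hp (hC.ce S₁),
      ← M.ex_mul_past_fut hp hX han hS₁ hS₂]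
    exact M.ex_walk_mul_walk hp hX hunif hab hb
  have hpast : sqCond p D S₁ = sqCond p (M.ctx a) S₁ := by
    rw [sqCond_eq hp, sqCond_eq hp, ex_congr fun ω => mul_comm (ce p D S₁ ω) (S₁ ω),
      M.ex_mul_past_fut hp hX han hS₁ (hD.trans (ce_det D S₁)), ex_mul_ce hp (hC.ce S₁)]
  have hdet : Det D (M.ctx b) := fun ω ω' h => by
    simp only [Prod.mk.injEq, Alg.ctx, D] at h ⊢
    exact ⟨h.1.1, h.2⟩
  refine (sqCond_mono hp hdet (walk X 0 b)).trans_eq ?_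
  rw [funext (walk_add (X := X) (Nat.zero_le a) hab), sqCond_add, hpast, hcross]
  ring

lemma Alg.sqCond_walk_le (M : Alg Ω p Bool n k X) (hp : IsPMF p) (hX : IsProduct p n X)
    (hunif : ∀ j < n, ∀ b : Bool, pr p (fun ω => X j ω = b) = 1 / 2) {α : Type} (A : Ω → α)
    {a b : ℕ} (hab : a ≤ b) (hb : b ≤ n) : sqCond p A (walk X a b) ≤ (b : ℝ) - a := by
  obtain ⟨t, rfl⟩ := Nat.exists_eq_add_of_le hab
  refine (sqCond_le hp A _).trans_eq ?_
  rw [M.ex_walk_sq hp hX hunif hb]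
  push_cast; ring

lemma Alg.sqCond_block_le (M : Alg Ω p Bool n k X) (hp : IsPMF p) (hX : IsProduct p n X)
    (hunif : ∀ j < n, ∀ b : Bool, pr p (fun ω => X j ω = b) = 1 / 2) {a c b : ℕ}
    (hac : a ≤ c) (hcb : c ≤ b) (hb : b ≤ n) :
    sqCond p (fun ω => (M.ctx a ω, M.par b ω)) (walk X a b) ≤
      8 * ((c : ℝ) - a) * ∑ l ∈ Finset.Ico a c, (M.leak l + M.info b l * Real.log 2) +
        2 * ((b : ℝ) - c) := by
  rw [funext (walk_add (X := X) hac hcb)]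
  refine (sqCond_add_le hp _ _ _).trans (add_le_add ?_ (mul_le_mul_of_nonneg_left
    (M.sqCond_walk_le hp hX hunif _ hcb hb) two_pos.le))
  have h := sqCond_sum_le hp (fun ω => (M.ctx a ω, M.par b ω)) (Finset.Ico a c)
    (fun l ω => coin (X l ω))
  rw [Nat.card_Ico, Nat.cast_sub hac] at h
  have h' : ∑ l ∈ Finset.Ico a c,
      sqCond p (fun ω => (M.ctx a ω, M.par b ω)) (fun ω => coin (X l ω)) ≤
      4 * ∑ l ∈ Finset.Ico a c, (M.leak l + M.info b l * Real.log 2) := by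
    rw [Finset.mul_sum]
    refine Finset.sum_le_sum fun l hl => ?_
    rw [Finset.mem_Ico] at hl
    exact (M.sqCond_coin_le_of_le hp hX hl.1 (hl.2.trans_le hcb) hb).trans
      (M.sqCond_coin_le_info hp b l)
  have hca : (0 : ℝ) ≤ (c : ℝ) - a := sub_nonneg.2 (by exact_mod_cast hac)
  change 2 * sqCond p _ (fun ω => ∑ l ∈ Finset.Ico a c, coin (X l ω)) ≤ _
  nlinarith [mul_le_mul_of_nonneg_left h' hca]

lemma Alg.sqCond_passEnd_le (M : Alg Ω p Bool n k X) (hp : IsPMF p) (hX : IsProduct p n X)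
    (hunif : ∀ j < n, ∀ b : Bool, pr p (fun ω => X j ω = b) = 1 / 2) :
    sqCond p (M.passEnd k) (walk X 0 n) ≤ sqCond p (M.ctx n) (walk X 0 n) := by
  rcases Nat.eq_zero_or_pos k with rfl | hk
  · refine le_trans (le_of_eq ?_) (sqCond_nonneg hp _ _)
    have hinit : Det (M.past 0) (M.passEnd 0) := fun ω ω' h => (M.past_eq_iff.1 h).1
    rw [sqCond_eq hp, (M.indep_past_fut hp hX (Nat.zero_le n)).ex_mul (hinit.ce _)
      (M.det_walk_fut le_rfl), ex_walk hunif le_rfl, mul_zero]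
  · refine sqCond_mono hp (fun ω ω' h => ?_) _
    obtain ⟨m, rfl⟩ := Nat.exists_eq_succ_of_ne_zero hk.ne'
    exact congrFun (Prod.mk.inj h).2 ⟨m, Nat.lt_succ_self m⟩

end Information

section Scales

lemma sum_sub_shift_le {n r : ℕ} (hrn : r ≤ n) {V : ℕ → ℝ} (hV0 : ∀ b ≤ n, 0 ≤ V b)
    (hV : ∀ a b, a ≤ b → b ≤ n → V a ≤ V b) :
    ∑ b ∈ Finset.Ico r (n + 1), (V b - V (b - r)) ≤ r * V n := by
  have hshift : ∑ b ∈ Finset.Ico r (n + 1), V (b - r) = ∑ b ∈ Finset.range (n + 1 - r), V b := by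
    rw [Finset.sum_Ico_eq_sum_range]
    exact Finset.sum_congr rfl fun i _ => by rw [Nat.add_sub_cancel_left]
  have hhead : ∑ b ∈ Finset.Ico r (n + 1), V b ≤ ∑ b ∈ Finset.range (n + 1), V b := by
    refine Finset.sum_le_sum_of_subset_of_nonneg (fun b hb => ?_) fun b hb _ => hV0 b ?_
    · rw [Finset.mem_Ico] at hb; exact Finset.mem_range.2 hb.2
    · exact Nat.lt_succ_iff.1 (Finset.mem_range.1 hb)
  have hsplit := Finset.sum_range_add_sum_Ico V (Nat.sub_le (n + 1) r)
  have htail : ∑ b ∈ Finset.Ico (n + 1 - r) (n + 1), V b ≤ r * V n := by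
    refine (Finset.sum_le_card_nsmul _ _ (V n) fun b hb => hV b n ?_ le_rfl).trans_eq ?_
    · rw [Finset.mem_Ico] at hb; omega
    · rw [Nat.card_Ico, nsmul_eq_mul, Nat.sub_sub_self (by omega)]
  rw [Finset.sum_sub_distrib]
  linarith

lemma sum_window_le {n r r' : ℕ} {f : ℕ → ℝ} (hf : ∀ l, 0 ≤ f l) :
    ∑ b ∈ Finset.Ico r (n + 1), ∑ l ∈ Finset.Ico (b - r) (b - r'), f l ≤
      r * ∑ l ∈ Finset.range n, f l := by
  have hswap : ∑ b ∈ Finset.Ico r (n + 1), ∑ l ∈ Finset.Ico (b - r) (b - r'), f l ≤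
      ∑ b ∈ Finset.Ico r (n + 1), ∑ t ∈ Finset.range r, f (b - r + t) := by
    refine Finset.sum_le_sum fun b hb => ?_
    rw [Finset.sum_Ico_eq_sum_range]
    refine Finset.sum_le_sum_of_subset_of_nonneg (fun t ht => ?_) fun _ _ _ => hf _
    rw [Finset.mem_range] at ht ⊢
    omega
  refine hswap.trans ?_
  rw [Finset.sum_comm, ← nsmul_eq_mul]
  refine (Finset.sum_le_card_nsmul _ _ (∑ l ∈ Finset.range n, f l) fun t ht => ?_).trans_eq
    (by rw [Finset.card_range])
  rw [Finset.mem_range] at ht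
  have himg : ∑ b ∈ Finset.Ico r (n + 1), f (b - r + t) =
      ∑ l ∈ Finset.Ico t (n + 1 - r + t), f l := by
    rw [Finset.sum_Ico_eq_sum_range, Finset.sum_Ico_eq_sum_range, Nat.add_sub_cancel_right]
    exact Finset.sum_congr rfl fun i _ => by rw [Nat.add_sub_cancel_left, add_comm]
  rw [himg]
  refine Finset.sum_le_sum_of_subset_of_nonneg (fun l hl => ?_) fun _ _ _ => hf _
  rw [Finset.mem_Ico] at hl
  rw [Finset.mem_range]
  omega

lemma scale_lower_bound {n r r' : ℕ} {E L : ℝ} {V leak : ℕ → ℝ} {info : ℕ → ℕ → ℝ}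
    (hV0 : ∀ b ≤ n, 0 ≤ V b) (hV : ∀ a b, a ≤ b → b ≤ n → V a ≤ V b)
    (hleak : ∀ l, 0 ≤ leak l) (hinfo : ∀ b l, 0 ≤ info b l) (hL : 0 ≤ L)
    (hstep : ∀ a c b, a ≤ c → c ≤ b → b ≤ n → V a + ((b : ℝ) - a) ≤
      V b + (8 * ((c : ℝ) - a) * ∑ l ∈ Finset.Ico a c, (leak l + info b l * L) +
        2 * ((b : ℝ) - c)))
    (hr : 1 ≤ r) (hrr : r' ≤ r) (hrn : r ≤ n) (hVn : V n ≤ n - E) :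
    r * (E - r) ≤ 8 * r * (r * ∑ l ∈ Finset.range n, leak l +
      L * ∑ b ∈ Finset.Ico r (n + 1), ∑ l ∈ Finset.Ico (b - r) (b - r'), info b l) +
        2 * n * r' := by
  have hb : ∀ b ∈ Finset.Ico r (n + 1), (r : ℝ) ≤ (V b - V (b - r)) +
      (8 * r * (∑ l ∈ Finset.Ico (b - r) (b - r'), leak l +
        L * ∑ l ∈ Finset.Ico (b - r) (b - r'), info b l) + 2 * r') := by
    intro b hb
    rw [Finset.mem_Ico] at hb
    have h := hstep (b - r) (b - r') b (by omega) (by omega) (by omega)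
    rw [Nat.cast_sub hb.1, Nat.cast_sub (hrr.trans hb.1), Finset.sum_add_distrib,
      ← Finset.sum_mul] at h
    have h1 : 0 ≤ ∑ l ∈ Finset.Ico (b - r) (b - r'), leak l := Finset.sum_nonneg fun l _ => hleak l
    have h2 : 0 ≤ L * ∑ l ∈ Finset.Ico (b - r) (b - r'), info b l :=
      mul_nonneg hL (Finset.sum_nonneg fun l _ => hinfo b l)
    have h3 : (0 : ℝ) ≤ r' := r'.cast_nonneg
    nlinarith [mul_nonneg h3 (add_nonneg h1 h2)]
  have hsum := Finset.sum_le_sum hb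
  rw [Finset.sum_const, Nat.card_Ico, nsmul_eq_mul, Finset.sum_add_distrib,
    Finset.sum_add_distrib, ← Finset.mul_sum, Finset.sum_add_distrib, ← Finset.mul_sum,
    Finset.sum_const, Nat.card_Ico, nsmul_eq_mul, Nat.cast_sub (by omega)] at hsum
  push_cast at hsum
  have hA := sum_sub_shift_le hrn hV0 hV
  have hB := sum_window_le (n := n) (r := r) (r' := r') hleak
  have hr0 : (1 : ℝ) ≤ r := by exact_mod_cast hr
  have h3 : (0 : ℝ) ≤ r' := r'.cast_nonneg
  nlinarith [mul_le_mul_of_nonneg_left hVn (r.cast_nonneg (α := ℝ)),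
    mul_le_mul_of_nonneg_left hB (r.cast_nonneg (α := ℝ)), mul_nonneg h3 (sub_nonneg.2 hr0)]

lemma sum_geometric_windows_le {c L b : ℕ} (hc : 1 ≤ c) {f : ℕ → ℝ} (hf : ∀ l, 0 ≤ f l) :
    ∑ i ∈ Finset.range L, ∑ l ∈ Finset.Ico (b - c ^ (i + 1)) (b - c ^ i), f l ≤
      ∑ l ∈ Finset.range b, f l := by
  have h : ∑ i ∈ Finset.range L, ∑ l ∈ Finset.Ico (b - c ^ (i + 1)) (b - c ^ i), f l =
      ∑ l ∈ Finset.Ico (b - c ^ L) (b - c ^ 0), f l := by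
    induction L with
    | zero => simp
    | succ L ih =>
      rw [Finset.sum_range_succ, ih, add_comm, Finset.sum_Ico_consecutive]
      · exact Nat.sub_le_sub_left (Nat.pow_le_pow_right hc (Nat.le_succ L)) b
      · exact Nat.sub_le_sub_left (Nat.pow_le_pow_right hc (Nat.zero_le L)) b
  rw [h]
  refine Finset.sum_le_sum_of_subset_of_nonneg (fun l hl => ?_) fun _ _ _ => hf _
  rw [Finset.mem_Ico] at hl
  rw [Finset.mem_range]
  omega

lemma sum_scales_le {c L n : ℕ} (hc : 1 ≤ c) {info : ℕ → ℕ → ℝ} (hinfo : ∀ b l, 0 ≤ info b l) :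
    ∑ i ∈ Finset.range L, ∑ b ∈ Finset.Ico (c ^ (i + 1)) (n + 1),
      ∑ l ∈ Finset.Ico (b - c ^ (i + 1)) (b - c ^ i), info b l ≤
        ∑ j ∈ Finset.range n, ∑ l ∈ Finset.range (j + 1), info (j + 1) l := by
  have h : ∀ i ∈ Finset.range L, ∑ b ∈ Finset.Ico (c ^ (i + 1)) (n + 1),
      ∑ l ∈ Finset.Ico (b - c ^ (i + 1)) (b - c ^ i), info b l ≤
      ∑ j ∈ Finset.range n,
        ∑ l ∈ Finset.Ico (j + 1 - c ^ (i + 1)) (j + 1 - c ^ i), info (j + 1) l := by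
    intro i _
    rw [Finset.range_eq_Ico, Finset.sum_Ico_add'
      (fun b => ∑ l ∈ Finset.Ico (b - c ^ (i + 1)) (b - c ^ i), info b l) 0 n 1, zero_add]
    refine Finset.sum_le_sum_of_subset_of_nonneg (fun b hb => ?_)
      fun _ _ _ => Finset.sum_nonneg fun _ _ => hinfo _ _
    rw [Finset.mem_Ico] at hb ⊢
    exact ⟨(Nat.one_le_pow _ _ hc).trans hb.1, hb.2⟩
  refine (Finset.sum_le_sum h).trans ?_
  rw [Finset.sum_comm]
  exact Finset.sum_le_sum fun j _ => sum_geometric_windows_le hc (hinfo (j + 1))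

lemma scale_info_ge {q ε E K r r' c W : ℝ} (hε : 0 < ε) (hE : E = ε * q ^ 4) (hc : 2 ≤ c)
    (hcε : 32 ≤ c * ε) (hcq : c ≤ q) (hK : K ≤ q) (hr : 0 < r) (hrq : r ≤ q ^ 2)
    (hrr : r = c * r') (hW : 0 ≤ W)
    (h : r * (E - r) ≤ 8 * r * (r * K + Real.log 2 * W) + 2 * q ^ 4 * r') : E / 16 ≤ W := by
  have hq : 2 ≤ q := hc.trans hcq
  have hqε : 32 ≤ q * ε := hcε.trans (mul_le_mul_of_nonneg_right hcq hε.le)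
  have h32 : 32 * q ^ 3 ≤ E := by
    rw [hE]
    nlinarith [mul_le_mul_of_nonneg_left hqε (by positivity : 0 ≤ q ^ 3)]
  have hrK : r * K ≤ q ^ 3 := by
    calc r * K ≤ r * q := mul_le_mul_of_nonneg_left hK hr.le
      _ ≤ q ^ 2 * q := mul_le_mul_of_nonneg_right hrq (by linarith)
      _ = q ^ 3 := by ring
  have hq23 : q ^ 2 ≤ q ^ 3 := pow_le_pow_right₀ (by linarith) (by norm_num)
  have hr' : 16 * (2 * q ^ 4 * r') ≤ r * E := by
    have hr0 : 0 ≤ r' := by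
      by_contra hneg
      nlinarith
    rw [hE, hrr]
    nlinarith [mul_le_mul_of_nonneg_left hcε (mul_nonneg hr0 (by positivity : 0 ≤ q ^ 4))]
  have hlog : Real.log 2 * W ≤ W := by
    nlinarith [Real.log_two_lt_d9]
  have hdiv : E - r ≤ 8 * (r * K + Real.log 2 * W) + E / 16 := by
    refine le_of_mul_le_mul_left ?_ hr
    nlinarith
  have : 0 ≤ q ^ 3 := by positivity
  linarith

lemma le_sum_info_of_deficit {n c : ℕ} {ε : ℝ} {V leak : ℕ → ℝ} {info : ℕ → ℕ → ℝ} (hε : 0 < ε)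
    (hc : 2 ≤ c) (hcε : 32 ≤ c * ε) (hcn : c ^ 4 ≤ n)
    (hV0 : ∀ b ≤ n, 0 ≤ V b) (hV : ∀ a b, a ≤ b → b ≤ n → V a ≤ V b)
    (hleak : ∀ l, 0 ≤ leak l) (hinfo : ∀ b l, 0 ≤ info b l)
    (hstep : ∀ a c b, a ≤ c → c ≤ b → b ≤ n → V a + ((b : ℝ) - a) ≤
      V b + (8 * ((c : ℝ) - a) * ∑ l ∈ Finset.Ico a c, (leak l + info b l * Real.log 2) +
        2 * ((b : ℝ) - c)))
    (hVn : V n ≤ n - ε * n) (hK : ∑ l ∈ Finset.range n, leak l ≤ (n : ℝ) ^ (1 / 4 : ℝ)) :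
    Nat.log c (Nat.sqrt n) * (ε * n / 16) ≤
      ∑ j ∈ Finset.range n, ∑ l ∈ Finset.range (j + 1), info (j + 1) l := by
  refine le_trans ?_ (sum_scales_le (c := c) (L := Nat.log c (Nat.sqrt n)) (by omega) hinfo)
  have hn0 : (0 : ℝ) ≤ n := n.cast_nonneg
  have hq4 : ((n : ℝ) ^ (1 / 4 : ℝ)) ^ 4 = n := by
    rw [← Real.rpow_natCast, ← Real.rpow_mul hn0]
    norm_num
  have hq0 : (0 : ℝ) ≤ (n : ℝ) ^ (1 / 4 : ℝ) := Real.rpow_nonneg hn0 _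
  have hcq : (c : ℝ) ≤ (n : ℝ) ^ (1 / 4 : ℝ) := by
    refine le_of_pow_le_pow_left₀ (n := 4) (by norm_num) hq0 ?_
    rw [hq4]
    exact_mod_cast hcn
  have hcard : (Nat.log c (Nat.sqrt n) : ℝ) * (ε * n / 16) =
      ∑ _i ∈ Finset.range (Nat.log c (Nat.sqrt n)), ε * n / 16 := by
    rw [Finset.sum_const, Finset.card_range, nsmul_eq_mul]
  rw [hcard]
  refine Finset.sum_le_sum fun i hi => ?_
  have hs0 : Nat.sqrt n ≠ 0 := by
    rw [Ne, Nat.sqrt_eq_zero]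
    have := Nat.one_le_pow 4 c (by omega)
    omega
  have hrs : c ^ (i + 1) ≤ Nat.sqrt n :=
    (Nat.pow_le_pow_right (by omega) (Finset.mem_range.1 hi)).trans (Nat.pow_log_le_self c hs0)
  have hr1 : 1 ≤ c ^ (i + 1) := Nat.one_le_pow _ _ (by omega)
  refine scale_info_ge (q := (n : ℝ) ^ (1 / 4 : ℝ)) (r := (c ^ (i + 1) : ℕ)) (r' := (c ^ i : ℕ))
    (c := c) hε (by rw [hq4]) (by exact_mod_cast hc) hcε hcq hK (by exact_mod_cast hr1) ?_
    (by push_cast; ring) (Finset.sum_nonneg fun b _ => Finset.sum_nonneg fun l _ => hinfo b l) ?_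
  · refine le_of_pow_le_pow_left₀ (n := 2) (by norm_num) (by positivity) ?_
    rw [← pow_mul, hq4]
    exact_mod_cast (Nat.pow_le_pow_left hrs 2).trans (Nat.sqrt_le' n)
  · rw [hq4]
    exact scale_lower_bound hV0 hV hleak hinfo (Real.log_nonneg one_le_two) hstep hr1
      (Nat.pow_le_pow_right (by omega) i.le_succ) (hrs.trans (Nat.sqrt_le_self n)) hVn

lemma logb_le_log_sqrt {n c : ℕ} (hc : 2 ≤ c) (hcn : c ^ 4 ≤ n) :
    Real.logb 2 n ≤ 4 * Nat.log c (Nat.sqrt n) * Real.logb 2 c := by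
  have hL : 1 ≤ Nat.log c (Nat.sqrt n) := by
    refine Nat.le_log_of_pow_le (by omega) (Nat.le_sqrt'.2 (le_trans ?_ hcn))
    rw [← pow_mul]
    exact Nat.pow_le_pow_right (by omega) (by norm_num)
  have hn : n ≤ c ^ (4 * Nat.log c (Nat.sqrt n)) := by
    have h1 := Nat.lt_pow_succ_log_self (by omega : 1 < c) (Nat.sqrt n)
    have h2 := (Nat.lt_succ_sqrt' n).le.trans (Nat.pow_le_pow_left h1 2)
    rw [← pow_mul] at h2
    exact h2.trans (Nat.pow_le_pow_right (by omega) (by rw [Nat.succ_eq_add_one]; omega))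
  have hn0 : 0 < n := (Nat.pow_pos (by omega)).trans_le hcn
  calc Real.logb 2 n ≤ Real.logb 2 ((c : ℝ) ^ (4 * Nat.log c (Nat.sqrt n))) :=
        Real.logb_le_logb_of_le one_lt_two (by exact_mod_cast hn0) (by exact_mod_cast hn)
    _ = _ := by rw [Real.logb_pow]; push_cast; ring

end Scales

section Tradeoff

variable {Ω : Type} [Fintype Ω] {p : Ω → ℝ} {n k : ℕ} {X : ℕ → Ω → Bool}

lemma Alg.sum_leak_le_rpow (M : Alg Ω p Bool n k X) (hp : IsPMF p) (hX : IsProduct p n X)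
    (hunif : ∀ j < n, ∀ b : Bool, pr p (fun ω => X j ω = b) = 1 / 2)
    (hk : (k : ℝ) < (n : ℝ) ^ (1 / 8 : ℝ))
    (hH : ∀ i ≤ k, H p (M.passEnd i) ≤ (n : ℝ) ^ (1 / 8 : ℝ)) :
    ∑ l ∈ Finset.range n, M.leak l ≤ (n : ℝ) ^ (1 / 4 : ℝ) := by
  refine (M.sum_leak_le hp hX hunif).trans ((M.ent_starts_le hp hH).trans ?_)
  have hB : (0 : ℝ) ≤ (n : ℝ) ^ (1 / 8 : ℝ) := k.cast_nonneg.trans hk.le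
  have hsq : (n : ℝ) ^ (1 / 8 : ℝ) * (n : ℝ) ^ (1 / 8 : ℝ) = (n : ℝ) ^ (1 / 4 : ℝ) := by
    rw [← Real.rpow_add_of_nonneg n.cast_nonneg (by norm_num) (by norm_num)]
    norm_num
  rw [← hsq]
  calc _ ≤ (k : ℝ) * (n : ℝ) ^ (1 / 8 : ℝ) :=
        mul_le_of_le_one_right (mul_nonneg k.cast_nonneg hB) (by linarith [Real.log_two_lt_d9])
    _ ≤ _ := mul_le_mul_of_nonneg_right hk.le hB

lemma Alg.le_MICcond (M : Alg Ω p Bool n k X) (hp : IsPMF p) (hX : IsProduct p n X)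
    (hunif : ∀ j < n, ∀ b : Bool, pr p (fun ω => X j ω = b) = 1 / 2)
    {ε : ℝ} (hε : 0 < ε) {c : ℕ} (hc : 2 ≤ c) (hcε : 32 ≤ c * ε) (hcn : c ^ 4 ≤ n)
    (hk : (k : ℝ) < (n : ℝ) ^ (1 / 8 : ℝ))
    (hH : ∀ i ≤ k, H p (M.passEnd i) ≤ (n : ℝ) ^ (1 / 8 : ℝ))
    (hdef : ε * n ≤ sqCond p (M.passEnd k) (walk X 0 n)) :
    Nat.log c (Nat.sqrt n) * (ε * n / 16) ≤ M.MICcond := by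
  have hstep : ∀ a b, a ≤ b → b ≤ n → (b : ℝ) - sqCond p (M.ctx b) (walk X 0 b) ≥
      a - sqCond p (M.ctx a) (walk X 0 a) + (b - a) -
        sqCond p (fun ω => (M.ctx a ω, M.par b ω)) (walk X a b) := fun a b hab hb => by
    linarith [M.sqCond_walk_le_add hp hX hunif hab hb]
  refine le_sum_info_of_deficit (V := fun b => (b : ℝ) - sqCond p (M.ctx b) (walk X 0 b))
    (leak := M.leak) (info := M.info) hε hc hcε hcn (fun b hb => ?_) (fun a b hab hb => ?_)
    (M.leak_nonneg hp) (M.info_nonneg hp) (fun a c b hac hcb hb => ?_) ?_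
    (M.sum_leak_le_rpow hp hX hunif hk hH)
  · have h := M.sqCond_walk_le hp hX hunif (M.ctx b) (Nat.zero_le b) hb
    rw [Nat.cast_zero] at h
    linarith
  · linarith [hstep a b hab hb,
      M.sqCond_walk_le hp hX hunif (fun ω => (M.ctx a ω, M.par b ω)) hab hb]
  · linarith [hstep a b (hac.trans hcb) hb, M.sqCond_block_le hp hX hunif hac hcb hb]
  · linarith [M.sqCond_passEnd_le hp hX hunif]

end Tradeoff

/-- Theorem `th:main`: for every constant `ε > 0` there exist constants
`δ > 0`, `λ > 0` and `n₀` such that for all `n ≥ n₀` the following holds.  Let `M` be a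
`k`-pass streaming algorithm with `k < n^λ` on a stream of `n` i.i.d. uniform `{-1,1}`
bits.  If `MIC_cond(M) ≤ δ·n·log₂ n` and `H(M_i) ≤ n^λ` for every `i ∈ {0,…,k}`, then
`E_{M_{(k,n)}} (E[Σ_{j=1}^n X_j | M_{(k,n)}])² ≤ ε·n`. -/
theorem coin_information_variance_tradeoff :
    ∀ ε : ℝ, 0 < ε →
      ∃ δ : ℝ, 0 < δ ∧ ∃ lam : ℝ, 0 < lam ∧ ∃ n₀ : ℕ,
        ∀ n : ℕ, n₀ ≤ n →
          ∀ (k : ℕ) (Ω : Type) [Fintype Ω], ∀ (p : Ω → ℝ) (X : ℕ → Ω → Bool)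
            (M : Alg Ω p Bool n k X),
            IsPMF p →
            IsProduct p n X →
            (∀ j < n, ∀ b : Bool, pr p (fun ω => X j ω = b) = 1 / 2) →
            (k : ℝ) < (n : ℝ) ^ lam →
            (∀ i ≤ k, H p (M.passEnd i) ≤ (n : ℝ) ^ lam) →
            M.MICcond ≤ δ * (n * Real.logb 2 n) →
            expSqCond p (fun ω => ∑ j ∈ Finset.range n, coin (X j ω)) (M.passEnd k)
              ≤ ε * n := by
  intro ε hε
  set c : ℕ := ⌈32 / ε⌉₊ + 2
  have hc : 2 ≤ c := Nat.le_add_left 2 _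
  have hcε : 32 ≤ c * ε := by
    rw [← div_le_iff₀ hε]
    refine (Nat.le_ceil _).trans ?_
    exact_mod_cast Nat.le_add_right _ 2
  have hlogc : 0 < Real.logb 2 c := Real.logb_pos one_lt_two (by exact_mod_cast hc)
  refine ⟨ε / (128 * Real.logb 2 c), by positivity, 1 / 8, by norm_num, c ^ 4, ?_⟩
  intro n hn k Ω _ p X M hp hX hunif hk hH hMIC
  by_contra! hdef
  rw [expSqCond_eq_sqCond, Finset.range_eq_Ico] at hdef
  have hge := M.le_MICcond hp hX hunif hε hc hcε hn hk hH hdef.le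
  have hlog := logb_le_log_sqrt hc hn
  have hn1 : 1 < n := (Nat.one_lt_pow (by norm_num) hc).trans_le hn
  have hlogn : 0 < Real.logb 2 n := Real.logb_pos one_lt_two (by exact_mod_cast hn1)
  have hεn : 0 < ε * n := mul_pos hε (by exact_mod_cast hn1.pos)
  have h := hge.trans hMIC
  have hδ : ε / (128 * Real.logb 2 c) * (n * Real.logb 2 n) * (128 * Real.logb 2 c) =
      ε * n * Real.logb 2 n := by
    field_simp
  have h' := mul_le_mul_of_nonneg_right h (by positivity : 0 ≤ 128 * Real.logb 2 c)
  rw [hδ] at h'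
  nlinarith [mul_le_mul_of_nonneg_left hlog hεn.le, mul_pos hεn hlogn]

end MultiPassIC
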